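/- Let m be a positive integer or half-integer (2m ∈ ℕ), let n, ν be integers with 0 ≤ n < 2m and 0 ≤ ν ≤ 2m, and let a ∈ ℤ. Let τ lie in the upper half-plane and z ∈ ℂ with m·z ∉ ℤ + ℤτ. Then F^{[m](a,0)}_{n,ν}(−1/τ, z/τ) = (i(−iτ)^{3/2}/(2m√(2m+1))) e^{πiaz/τ} e^{−πia²/(2mτ)} e^{πim(z−a/m)²/(2τ)} ∑_{n'=0}^{2m−1} ∑_{ν'=0}^{2m} ∑_{ℓ=0}^{2m−1} (−1)^{ν+ν'} e^{−2πi(ν+1/2)(ν'+1/2)/(2m+1)} e^{−πin'a/m} e^{−πi(n+a)ℓ/m} F^{[m](ℓ,0)}_{n',ν'}(τ, z), where (−iτ)^{3/2} denotes the principal branch. -/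

import Mathlib

noncomputable section

open Complex

/-- `e2 w = exp (2 π i w)`; with `q = e^{2πiτ}`, the power `q^x` corresponds to `e2 (x * τ)`. -/
def e2 (w : ℂ) : ℂ := Complex.exp (2 * (Real.pi : ℂ) * Complex.I * w)

/-- Jacobi-type theta function `θ^{(ε)}_{n,m}(τ, z) = ∑_{j∈ℤ} ε^j q^{m(j+n/(2m))²} e^{2πim(j+n/(2m))z}`. -/
def jtheta (ε n m τ z : ℂ) : ℂ :=
  ∑' j : ℤ, ε ^ j *
    e2 (m * ((j : ℂ) + n / (2 * m)) ^ 2 * τ + m * ((j : ℂ) + n / (2 * m)) * z)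

/-- Mock theta function `Φ₁^{(ε)[m,s]}(τ, z₁, z₂)`. -/
def Phi1 (ε m s τ z₁ z₂ : ℂ) : ℂ :=
  ∑' j : ℤ, ε ^ j *
    e2 (m * (j : ℂ) * (z₁ + z₂) + s * z₁ + (m * (j : ℂ) ^ 2 + s * (j : ℂ)) * τ) /
      (1 - e2 (z₁ + (j : ℂ) * τ))

/-- Dedekind eta function `η(τ) = q^{1/24} ∏_{k≥1} (1 - q^k)`. -/
def dedekindEta (τ : ℂ) : ℂ := e2 (τ / 24) * ∏' k : ℕ, (1 - e2 (((k : ℂ) + 1) * τ))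

/-- Jacobi theta `ϑ₁₁(τ, z) = i ∑_{j∈ℤ} (−1)^j q^{(j+1/2)²/2} e^{2πi(j+1/2)z}`. -/
def theta11 (τ z : ℂ) : ℂ :=
  Complex.I * ∑' j : ℤ, (-1 : ℂ) ^ j *
    e2 (((j : ℂ) + 1 / 2) ^ 2 / 2 * τ + ((j : ℂ) + 1 / 2) * z)

/-- Indefinite double sum `(∑_{j,p∈ℤ, 0<p≤j} − ∑_{j,p∈ℤ, j<p≤0}) f j p`. -/
def indefSum (f : ℤ → ℤ → ℂ) : ℂ :=
  ∑' jp : ℤ × ℤ,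
    ((if 0 < jp.2 ∧ jp.2 ≤ jp.1 then f jp.1 jp.2 else 0) -
      (if jp.1 < jp.2 ∧ jp.2 ≤ 0 then f jp.1 jp.2 else 0))

/-- `g^{[m]}_{n,ν}(τ)`. -/
def gfun (m : ℂ) (n ν : ℤ) (τ : ℂ) : ℂ :=
  indefSum fun j p =>
    (-1 : ℂ) ^ j *
      e2 (((m + 1 / 2) * ((j : ℂ) + (ν : ℂ) - ((ν : ℂ) + 1 / 2) / (2 * m + 1)) ^ 2 -
        m * ((p : ℂ) + (ν : ℂ) - (n : ℂ) / (2 * m)) ^ 2) * τ)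

/-- `h^{[m]}_{n,ν}(τ, z)`. -/
def hfun (m : ℂ) (n ν : ℤ) (τ z : ℂ) : ℂ :=
  ∑' j : ℤ,
    e2 (m * (j : ℂ) * z + (n : ℂ) * z / 2 +
        (m * (j : ℂ) ^ 2 + (n : ℂ) * ((j : ℂ) + (ν : ℂ))) * τ) /
      (1 - e2 (m * z + 2 * m * ((j : ℂ) + (ν : ℂ)) * τ))

/-- `G^{[m]}_{n,ν}(τ, z)`. -/
def Gfun (m : ℂ) (n ν : ℤ) (τ z : ℂ) : ℂ :=
  gfun m n ν τ * jtheta 1 (n : ℂ) m τ z +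
    (-1 : ℂ) ^ ν * e2 (-(m * (ν : ℂ) ^ 2) * τ) *
      jtheta (-1) ((ν : ℂ) + 1 / 2) (m + 1 / 2) τ 0 * hfun m n ν τ z

/-- `F^{[m](a,b)}_{n,ν}(τ, z)`. -/
def Ffun (m : ℂ) (a b n ν : ℤ) (τ z : ℂ) : ℂ :=
  e2 ((a : ℂ) * z / 2 + (a : ℂ) ^ 2 / (4 * m) * τ) *
    Gfun m n ν τ (z + (a : ℂ) * τ / m + (b : ℂ) / m)

/-- The coefficient `f_{j,k}` of Lemma 3.1:
`f_{j,k} = (−1)^j q^{(m+1/2)(j+s/(2m+1))² − k²/(4m)} e^{−2πijm(z₁−z₂)+πik(z₁−z₂)}`. -/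
def fcoef (m s τ z₁ z₂ : ℂ) (j k : ℤ) : ℂ :=
  (-1 : ℂ) ^ j *
    e2 (((m + 1 / 2) * ((j : ℂ) + s / (2 * m + 1)) ^ 2 - (k : ℂ) ^ 2 / (4 * m)) * τ +
      (-((j : ℂ) * m) + (k : ℂ) / 2) * (z₁ - z₂))

/-! ### Basic facts on `e2` -/

theorem e2_add (x y : ℂ) : e2 (x + y) = e2 x * e2 y := by
  simp only [e2, mul_add, Complex.exp_add]

theorem e2_zero : e2 0 = 1 := by simp [e2]

theorem e2_ne_zero (x : ℂ) : e2 x ≠ 0 := Complex.exp_ne_zero _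

theorem e2_int (k : ℤ) : e2 (k : ℂ) = 1 := by
  rw [e2, Complex.exp_eq_one_iff]
  exact ⟨k, by ring⟩

theorem e2_half : e2 (1 / 2) = -1 := by
  rw [e2, ← Complex.exp_pi_mul_I]
  congr 1; ring

theorem e2_neg (x : ℂ) : e2 (-x) = (e2 x)⁻¹ := by
  rw [e2, e2, ← Complex.exp_neg]; congr 1; ring

theorem e2_int_mul (k : ℤ) (x : ℂ) : e2 (k * x) = e2 x ^ k := by
  rw [e2, e2, ← Complex.exp_int_mul]; congr 1; ring

theorem e2_nat_mul (k : ℕ) (x : ℂ) : e2 (k * x) = e2 x ^ k := by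
  have := e2_int_mul k x
  simpa using this

theorem e2_eq_of_sub (x y : ℂ) (k : ℤ) (h : x = y + k) : e2 x = e2 y := by
  rw [h, e2_add, e2_int, mul_one]

theorem neg_one_zpow_e2 (k : ℤ) : (-1 : ℂ) ^ k = e2 ((k : ℂ) / 2) := by
  rw [← e2_half, ← e2_int_mul]; congr 1; ring

theorem norm_e2 (x : ℂ) : ‖e2 x‖ = Real.exp (-(2 * Real.pi * x.im)) := by
  rw [e2, Complex.norm_exp]
  congr 1
  simp

theorem e2_eq_one_iff (x : ℂ) : e2 x = 1 ↔ ∃ k : ℤ, x = k := by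
  constructor
  · intro h
    rw [e2, Complex.exp_eq_one_iff] at h
    obtain ⟨k, hk⟩ := h
    refine ⟨k, ?_⟩
    have h2 : (2 * (Real.pi : ℂ) * Complex.I) ≠ 0 := Complex.two_pi_I_ne_zero
    apply mul_left_cancel₀ h2
    rw [hk]; ring
  · rintro ⟨k, rfl⟩
    exact e2_int k

theorem differentiable_e2 : Differentiable ℂ e2 := by
  unfold e2
  fun_prop

theorem e2_term (T v : ℂ) (j : ℤ) : e2 ((j : ℂ) ^ 2 / 2 * T + j * v) = jacobiTheta₂_term j v T := by
  rw [e2, jacobiTheta₂_term]; congr 1; ring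

theorem summable_gauss {T : ℂ} (hT : 0 < T.im) (v : ℂ) :
    Summable fun j : ℤ => e2 ((j : ℂ) ^ 2 / 2 * T + j * v) := by
  simp only [e2_term]
  exact (summable_jacobiTheta₂_term_iff v T).2 hT

/-- signed indicator -/
def sg (j l : ℤ) : ℂ := (if 0 ≤ l then 1 else 0) - (if j < 0 then 1 else 0)

/-! ### Lerch type sums -/

def lt (T τ v w : ℂ) (j : ℤ) : ℂ := e2 ((j : ℂ) ^ 2 / 2 * T + j * v) / (1 - e2 (w + j * τ))

theorem summable_exp_abs {c : ℝ} (hc : 0 < c) : Summable fun l : ℤ => Real.exp (-(c * |(l : ℝ)|)) := by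
  have h : Summable fun n : ℕ => Real.exp (-(c * (n : ℝ))) := by
    have := Real.summable_exp_nat_mul_iff.2 (neg_lt_zero.2 hc)
    refine this.congr fun n => ?_
    congr 1; ring
  apply Summable.of_nat_of_neg
  · refine h.congr fun n => ?_
    simp
  · refine h.congr fun n => ?_
    simp

theorem hasSum_geom (x : ℂ) (j : ℤ) (h1 : 0 ≤ j → ‖x‖ < 1) (h2 : j < 0 → 1 < ‖x‖) :
    HasSum (fun l : ℤ => sg j l * x ^ l) (1 / (1 - x)) := by
  have hI : Function.Injective (fun n : ℕ => (n : ℤ)) := fun a b h => by simpa using h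
  have hI2 : Function.Injective (fun n : ℕ => -(n : ℤ) - 1) := fun a b h => by
    simp only [] at h; omega
  rcases le_or_gt 0 j with hj | hj
  · have hx := h1 hj
    have hg := hasSum_geometric_of_norm_lt_one hx
    rw [one_div]
    rw [← hI.hasSum_iff]
    · refine hg.congr_fun ?_
      intro n
      simp [sg, not_lt.2 hj]
    · intro l hl
      have : ¬ 0 ≤ l := fun h => hl ⟨l.toNat, by simp [h]⟩
      simp [sg, this, not_lt.2 hj]
  · have hx := h2 hj
    have hx0 : x ≠ 0 := by rintro rfl; simp at hx; linarith
    have hx1 : x ≠ 1 := by rintro rfl; simp at hx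
    have hxi : ‖x⁻¹‖ < 1 := by
      rw [norm_inv]; exact inv_lt_one_of_one_lt₀ hx
    have hg := (hasSum_geometric_of_norm_lt_one hxi).mul_left (-x⁻¹)
    have e : -x⁻¹ * (1 - x⁻¹)⁻¹ = 1 / (1 - x) := by
      have : 1 - x ≠ 0 := sub_ne_zero.2 (Ne.symm hx1)
      have h3 : x - 1 ≠ 0 := sub_ne_zero.2 hx1
      have h4 : 1 - x⁻¹ ≠ 0 := by
        intro h
        apply hx1
        rw [sub_eq_zero] at h
        rw [← inv_inv x, ← h, inv_one]
      field_simp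
      ring
    rw [e] at hg
    rw [← hI2.hasSum_iff]
    · refine hg.congr_fun ?_
      intro n
      have : ¬ (0 : ℤ) ≤ -(n : ℤ) - 1 := by omega
      simp only [Function.comp, sg, this, hj, if_true, if_false]
      rw [zpow_sub₀ hx0, zpow_neg, zpow_natCast, inv_pow]
      simp
      ring
    · intro l hl
      have : 0 ≤ l := by
        by_contra h
        exact hl ⟨(-l - 1).toNat, by simp only []; omega⟩
      simp [sg, this, hj]

theorem sg_bound (j l : ℤ) : ‖sg j l‖ ≤ 1 := by
  unfold sg; split_ifs <;> simp

theorem lt_expand {T τ v w : ℂ} (hT : 0 < T.im) (hw0 : 0 < w.im) (hw1 : w.im < τ.im) :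
    (Summable fun p : ℤ × ℤ => ‖sg p.1 p.2 *
      e2 ((p.1 : ℂ) ^ 2 / 2 * T + p.1 * v + p.2 * (w + p.1 * τ))‖) ∧
    ∑' p : ℤ × ℤ, sg p.1 p.2 * e2 ((p.1 : ℂ) ^ 2 / 2 * T + p.1 * v + p.2 * (w + p.1 * τ)) =
      ∑' j : ℤ, lt T τ v w j := by
  have hτ : 0 < τ.im := hw0.trans hw1
  have hS : Summable fun p : ℤ × ℤ => ‖sg p.1 p.2 *
      e2 ((p.1 : ℂ) ^ 2 / 2 * T + p.1 * v + p.2 * (w + p.1 * τ))‖ := by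
    set δ := min w.im (τ.im - w.im) with hδ
    have hδ0 : 0 < δ := lt_min hw0 (by linarith)
    have hδ1 : δ ≤ w.im := min_le_left _ _
    have hδ2 : δ ≤ τ.im - w.im := min_le_right _ _
    have hb := (summable_gauss hT v).norm.mul_of_nonneg
      (summable_exp_abs (c := 2 * Real.pi * δ) (by positivity))
      (fun _ => norm_nonneg _) (fun _ => (Real.exp_pos _).le)
    refine hb.of_nonneg_of_le (fun _ => norm_nonneg _) ?_
    rintro ⟨j, l⟩
    simp only []
    rw [e2_add, norm_mul, norm_mul]
    have key : ‖sg j l‖ * ‖e2 (l * (w + j * τ))‖ ≤ Real.exp (-(2 * Real.pi * δ * |(l : ℝ)|)) := by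
      by_cases h0 : sg j l = 0
      · rw [h0]; simp; positivity
      have him : ((l : ℂ) * (w + j * τ)).im = l * (w.im + j * τ.im) := by
        simp
      have hge : δ * |(l : ℝ)| ≤ l * (w.im + j * τ.im) := by
        rcases le_or_gt 0 j with hj | hj
        · have hl : 0 ≤ l := by
            by_contra h; apply h0; simp [sg, h, not_lt.2 hj]
          have hl' : (0 : ℝ) ≤ l := by exact_mod_cast hl
          have hj' : (0 : ℝ) ≤ j := by exact_mod_cast hj
          rw [abs_of_nonneg hl', mul_comm]
          apply mul_le_mul_of_nonneg_left _ hl'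
          nlinarith
        · have hl : l < 0 := by
            by_contra h; apply h0; simp [sg, hj, not_lt.1 h]
          have hl' : (l : ℝ) < 0 := by exact_mod_cast hl
          have hj' : (j : ℝ) ≤ -1 := by exact_mod_cast (by omega : j ≤ -1)
          rw [abs_of_neg hl']
          have : w.im + j * τ.im ≤ -δ := by nlinarith
          nlinarith
      calc ‖sg j l‖ * ‖e2 (l * (w + j * τ))‖ ≤ 1 * ‖e2 (l * (w + j * τ))‖ :=
            mul_le_mul_of_nonneg_right (sg_bound _ _) (norm_nonneg _)
        _ ≤ _ := by
            rw [one_mul, norm_e2, him]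
            apply Real.exp_le_exp.2
            have := Real.pi_pos
            nlinarith
    calc _ = ‖e2 ((j : ℂ) ^ 2 / 2 * T + j * v)‖ * (‖sg j l‖ * ‖e2 (l * (w + j * τ))‖) := by ring
      _ ≤ _ := mul_le_mul_of_nonneg_left key (norm_nonneg _)
  refine ⟨hS, ?_⟩
  rw [hS.of_norm.tsum_prod]
  apply tsum_congr
  intro j
  have him : (w + (j : ℂ) * τ).im = w.im + j * τ.im := by simp
  have hg := hasSum_geom (e2 (w + j * τ)) j (by
      intro hj
      have hj' : (0 : ℝ) ≤ j := by exact_mod_cast hj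
      rw [norm_e2, him]
      apply Real.exp_lt_one_iff.2
      have := Real.pi_pos
      have : 0 < w.im + j * τ.im := by nlinarith
      have : 0 < 2 * Real.pi * (w.im + j * τ.im) := by positivity
      linarith) (by
      intro hj
      have hj' : (j : ℝ) ≤ -1 := by exact_mod_cast (by omega : j ≤ -1)
      rw [norm_e2, him]
      apply Real.one_lt_exp_iff.2
      have := Real.pi_pos
      have : 0 < -(w.im + j * τ.im) := by nlinarith
      have : 0 < 2 * Real.pi * (-(w.im + j * τ.im)) := by positivity
      linarith)
  have := (hg.mul_left (e2 ((j : ℂ) ^ 2 / 2 * T + j * v))).tsum_eq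
  rw [lt, div_eq_mul_one_div, ← this]
  apply tsum_congr
  intro l
  rw [e2_add, e2_int_mul]
  ring

/-- local uniform bound for the denominators -/
theorem den_bound {τ : ℂ} (hτ : 0 < τ.im) (w₀ : ℂ) (S : Set ℤ)
    (hS : ∀ j ∈ S, e2 (w₀ + j * τ) ≠ 1) :
    ∃ B : ℝ, ∀ᶠ w in nhds w₀, ∀ j ∈ S, (1 - e2 (w + j * τ)) ≠ 0 ∧ ‖(1 - e2 (w + j * τ))⁻¹‖ ≤ B := by
  have hfin : {j : ℤ | |w₀.im + j * τ.im| < 2}.Finite := by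
    apply Set.Finite.subset (Set.finite_Icc (⌊(-2 - w₀.im) / τ.im⌋) ⌈(2 - w₀.im) / τ.im⌉)
    intro j hj
    simp only [Set.mem_ofPred_eq, abs_lt] at hj
    refine ⟨?_, ?_⟩
    · have : (-2 - w₀.im) / τ.im < j := by rw [div_lt_iff₀ hτ]; linarith
      exact_mod_cast ((Int.floor_le _).trans this.le)
    · have : (j : ℝ) < (2 - w₀.im) / τ.im := by rw [lt_div_iff₀ hτ]; linarith
      exact_mod_cast (this.le.trans (Int.le_ceil _))
  have hcont : ∀ j : ℤ, ContinuousAt (fun w => 1 - e2 (w + j * τ)) w₀ := by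
    intro j
    have := differentiable_e2.continuous
    fun_prop
  have h1 : ∀ j ∈ {j : ℤ | |w₀.im + j * τ.im| < 2} ∩ S, ∀ᶠ w in nhds w₀,
      (1 - e2 (w + j * τ)) ≠ 0 ∧
        ‖(1 - e2 (w + j * τ))⁻¹‖ ≤ ‖(1 - e2 (w₀ + j * τ))⁻¹‖ + 1 := by
    rintro j ⟨-, hj⟩
    have hne : 1 - e2 (w₀ + j * τ) ≠ 0 := sub_ne_zero.2 (Ne.symm (hS j hj))
    have hc := ((hcont j).inv₀ hne).norm
    filter_upwards [(hcont j).eventually_ne hne,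
      hc.eventually_lt continuousAt_const (lt_add_one _)] with w ha hb
    exact ⟨ha, hb.le⟩
  have h2 := (Filter.eventually_all_finite (hfin.inter_of_left S)).2 h1
  refine ⟨2 + ∑ j ∈ (hfin.inter_of_left S).toFinset, (‖(1 - e2 (w₀ + j * τ))⁻¹‖ + 1), ?_⟩
  filter_upwards [h2, Metric.ball_mem_nhds w₀ one_pos] with w hw hwb j hj
  have hsum : 0 ≤ ∑ j ∈ (hfin.inter_of_left S).toFinset, (‖(1 - e2 (w₀ + j * τ))⁻¹‖ + 1) :=
    Finset.sum_nonneg fun _ _ => by positivity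
  by_cases hjs : |w₀.im + j * τ.im| < 2
  · obtain ⟨ha, hb⟩ := hw j ⟨hjs, hj⟩
    refine ⟨ha, hb.trans ?_⟩
    have := Finset.single_le_sum (f := fun j : ℤ => ‖(1 - e2 (w₀ + j * τ))⁻¹‖ + 1)
      (fun _ _ => by positivity) ((hfin.inter_of_left S).mem_toFinset.2 ⟨hjs, hj⟩)
    linarith
  · have hd : |(w - w₀).im| < 1 := by
      refine (Complex.abs_im_le_norm _).trans_lt ?_
      rwa [Metric.mem_ball, dist_eq_norm] at hwb
    rw [Complex.sub_im, abs_lt] at hd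
    have him : (w + (j : ℂ) * τ).im = w.im + j * τ.im := by simp
    have hpi := Real.pi_gt_three
    suffices h : 1 / 2 ≤ ‖1 - e2 (w + j * τ)‖ by
      refine ⟨fun h0 => by rw [h0] at h; simp at h; linarith, ?_⟩
      rw [norm_inv]
      have : ‖1 - e2 (w + j * τ)‖⁻¹ ≤ (1 / 2)⁻¹ := inv_anti₀ (by norm_num) h
      norm_num at this
      linarith
    rw [not_lt, le_abs] at hjs
    rcases hjs with h | h
    · have h3 : ‖e2 (w + j * τ)‖ ≤ 1 / 2 := by
        rw [norm_e2, him]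
        have h4 : 1 ≤ w.im + j * τ.im := by linarith
        have h5 : (1 : ℝ) + 1 ≤ Real.exp 1 := Real.add_one_le_exp 1
        calc Real.exp (-(2 * Real.pi * (w.im + j * τ.im))) ≤ Real.exp (-1) :=
              Real.exp_le_exp.2 (by nlinarith)
          _ = (Real.exp 1)⁻¹ := Real.exp_neg 1
          _ ≤ (2 : ℝ)⁻¹ := inv_anti₀ (by norm_num) (by linarith)
          _ = 1 / 2 := by norm_num
      have := norm_sub_norm_le 1 (e2 (w + j * τ))
      rw [norm_one] at this
      linarith
    · have h3 : 2 ≤ ‖e2 (w + j * τ)‖ := by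
        rw [norm_e2, him]
        have h4 : w.im + j * τ.im ≤ -1 := by linarith
        have h5 : (1 : ℝ) + 1 ≤ Real.exp 1 := Real.add_one_le_exp 1
        calc (2 : ℝ) ≤ Real.exp 1 := by linarith
          _ ≤ _ := Real.exp_le_exp.2 (by nlinarith)
      have := norm_sub_norm_le (e2 (w + j * τ)) 1
      rw [norm_one, norm_sub_rev] at this
      linarith

theorem num_bound {T : ℂ} (v₀ w₀ : ℂ) (N : ℝ) (j : ℤ) (w : ℂ) (hw : w ∈ Metric.ball w₀ 1) :
    ‖e2 ((j : ℂ) ^ 2 / 2 * T + j * (v₀ + N * w))‖ ≤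
      ‖e2 ((j : ℂ) ^ 2 / 2 * T + j * (v₀ + N * w₀ + |N| * Complex.I))‖ +
      ‖e2 ((j : ℂ) ^ 2 / 2 * T + j * (v₀ + N * w₀ - |N| * Complex.I))‖ := by
  have hd : |(w - w₀).im| < 1 := by
    refine (Complex.abs_im_le_norm _).trans_lt ?_
    rwa [Metric.mem_ball, dist_eq_norm] at hw
  rw [Complex.sub_im] at hd
  have h1 : |N * (w.im - w₀.im)| ≤ |N| := by
    rw [abs_mul]; nlinarith [abs_nonneg N]
  rw [abs_le] at h1
  simp only [e2_add, norm_mul, norm_e2, ← mul_add]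
  apply mul_le_mul_of_nonneg_left _ (Real.exp_pos _).le
  have i1 : ((j : ℂ) * (v₀ + N * w)).im = j * (v₀.im + N * w.im) := by simp
  have i2 : ((j : ℂ) * (v₀ + N * w₀ + |N| * Complex.I)).im = j * (v₀.im + N * w₀.im + |N|) := by simp
  have i3 : ((j : ℂ) * (v₀ + N * w₀ - |N| * Complex.I)).im = j * (v₀.im + N * w₀.im - |N|) := by simp
  rw [i1, i2, i3]
  have hpi := Real.pi_pos
  rcases le_total (0 : ℝ) j with hj | hj
  · have : Real.exp (-(2 * Real.pi * (j * (v₀.im + N * w.im)))) ≤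
        Real.exp (-(2 * Real.pi * (j * (v₀.im + N * w₀.im - |N|)))) := by
      apply Real.exp_le_exp.2
      have : j * (v₀.im + N * w₀.im - |N|) ≤ j * (v₀.im + N * w.im) :=
        mul_le_mul_of_nonneg_left (by linarith) hj
      nlinarith
    linarith [Real.exp_pos (-(2 * Real.pi * (j * (v₀.im + N * w₀.im + |N|))))]
  · have : Real.exp (-(2 * Real.pi * (j * (v₀.im + N * w.im)))) ≤
        Real.exp (-(2 * Real.pi * (j * (v₀.im + N * w₀.im + |N|)))) := by
      apply Real.exp_le_exp.2
      have : j * (v₀.im + N * w₀.im + |N|) ≤ j * (v₀.im + N * w.im) :=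
        mul_le_mul_of_nonpos_left (by linarith) hj
      nlinarith
    linarith [Real.exp_pos (-(2 * Real.pi * (j * (v₀.im + N * w₀.im - |N|))))]

open Classical in
theorem lerch_analytic {T τ : ℂ} (hT : 0 < T.im) (hτ : 0 < τ.im) (v₀ w₀ : ℂ) (N : ℝ) (S : Set ℤ)
    (hS : ∀ j ∈ S, e2 (w₀ + j * τ) ≠ 1) :
    Summable (fun j : ℤ => if j ∈ S then lt T τ (v₀ + N * w₀) w₀ j else 0) ∧
    AnalyticAt ℂ (fun w => ∑' j : ℤ, if j ∈ S then lt T τ (v₀ + N * w) w j else 0) w₀ := by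
  obtain ⟨B, hB⟩ := den_bound hτ w₀ S hS
  have hB0 : ∀ᶠ w in nhds w₀, (∀ j ∈ S, (1 - e2 (w + j * τ)) ≠ 0 ∧
      ‖(1 - e2 (w + j * τ))⁻¹‖ ≤ |B|) ∧ w ∈ Metric.ball w₀ 1 := by
    filter_upwards [hB, Metric.ball_mem_nhds w₀ one_pos] with w hw hwb
    exact ⟨fun j hj => ⟨(hw j hj).1, (hw j hj).2.trans (le_abs_self _)⟩, hwb⟩
  obtain ⟨U, hU, hUo, hwU⟩ := eventually_nhds_iff.1 hB0
  set u : ℤ → ℝ := fun j => (‖e2 ((j : ℂ) ^ 2 / 2 * T + j * (v₀ + N * w₀ + |N| * Complex.I))‖ +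
      ‖e2 ((j : ℂ) ^ 2 / 2 * T + j * (v₀ + N * w₀ - |N| * Complex.I))‖) * |B| with hu
  have hus : Summable u :=
    ((summable_gauss hT _).norm.add (summable_gauss hT _).norm).mul_right _
  have hle : ∀ (j : ℤ) (w : ℂ), w ∈ U →
      ‖(if j ∈ S then lt T τ (v₀ + N * w) w j else 0)‖ ≤ u j := by
    intro j w hw
    split_ifs with hj
    · rw [lt, div_eq_mul_inv, norm_mul]
      exact mul_le_mul (num_bound v₀ w₀ N j w (hU w hw).2) ((hU w hw).1 j hj).2 (norm_nonneg _)
        (by positivity)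
    · rw [norm_zero]; positivity
  refine ⟨hus.of_norm_bounded (fun j => hle j w₀ hwU), ?_⟩
  refine DifferentiableOn.analyticAt (s := U) ?_ (hUo.mem_nhds hwU)
  refine differentiableOn_tsum_of_summable_norm hus ?_ hUo hle
  intro j w hw
  apply DifferentiableAt.differentiableWithinAt
  by_cases hj : j ∈ S
  · simp only [hj, if_true, lt]
    have h := ((hU w hw).1 j hj).1
    have hd := differentiable_e2
    apply DifferentiableAt.div
    · fun_prop
    · fun_prop
    · exact h
  · simp only [hj, if_false]
    exact differentiableAt_const _

/-! ### Theta functions -/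

def thterm (P : ℕ) (ν : ℤ) (τ w : ℂ) (k : ℤ) : ℂ :=
  e2 ((k : ℂ) / 2 + (P : ℂ) / 2 * (k + (ν + 1 / 2) / P) ^ 2 * τ + (P * k + ν + 1 / 2) * w)

def Th (P : ℕ) (ν : ℤ) (τ w : ℂ) : ℂ := ∑' k : ℤ, thterm P ν τ w k

theorem jtheta_eq_Th (P : ℕ) (hP : 0 < P) (ν : ℤ) (τ w : ℂ) :
    jtheta (-1) ((ν : ℂ) + 1 / 2) ((P : ℂ) / 2) τ (2 * w) = Th P ν τ w := by
  have hP' : (P : ℂ) ≠ 0 := by exact_mod_cast hP.ne'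
  unfold jtheta Th
  apply tsum_congr
  intro k
  rw [neg_one_zpow_e2, ← e2_add, thterm]
  congr 1
  field_simp
  ring

theorem thterm_eq (P : ℕ) (hP : 0 < P) (ν : ℤ) (τ w : ℂ) (k : ℤ) :
    thterm P ν τ w k = e2 ((ν + 1 / 2) ^ 2 / (2 * P) * τ + (ν + 1 / 2) * w) *
      e2 ((k : ℂ) ^ 2 / 2 * (P * τ) + k * (1 / 2 + (ν + 1 / 2) * τ + P * w)) := by
  have hP' : (P : ℂ) ≠ 0 := by exact_mod_cast hP.ne'
  rw [thterm, ← e2_add]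
  congr 1
  field_simp
  ring

theorem im_nat_mul {P : ℕ} (hP : 0 < P) {τ : ℂ} (hτ : 0 < τ.im) : 0 < ((P : ℂ) * τ).im := by
  have : (0 : ℝ) < P := by exact_mod_cast hP
  simp
  positivity

theorem summable_thterm {P : ℕ} (hP : 0 < P) (ν : ℤ) {τ : ℂ} (hτ : 0 < τ.im) (w : ℂ) :
    Summable (thterm P ν τ w) := by
  have := (summable_gauss (im_nat_mul hP hτ) (1 / 2 + (ν + 1 / 2) * τ + P * w)).mul_left
    (e2 ((ν + 1 / 2) ^ 2 / (2 * P) * τ + (ν + 1 / 2) * w))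
  exact this.congr fun k => (thterm_eq P hP ν τ w k).symm

theorem Th_eq {P : ℕ} (hP : 0 < P) (ν : ℤ) (τ w : ℂ) :
    Th P ν τ w = e2 ((ν + 1 / 2) ^ 2 / (2 * P) * τ + (ν + 1 / 2) * w) *
      jacobiTheta₂ (1 / 2 + (ν + 1 / 2) * τ + P * w) (P * τ) := by
  unfold Th jacobiTheta₂
  rw [← tsum_mul_left]
  apply tsum_congr
  intro k
  rw [thterm_eq P hP, e2_term]

theorem Th_differentiable {P : ℕ} (hP : 0 < P) (ν : ℤ) {τ : ℂ} (hτ : 0 < τ.im) :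
    Differentiable ℂ (Th P ν τ) := by
  have h : Th P ν τ = fun w => e2 ((ν + 1 / 2) ^ 2 / (2 * P) * τ + (ν + 1 / 2) * w) *
      jacobiTheta₂ (1 / 2 + (ν + 1 / 2) * τ + P * w) (P * τ) := funext fun w => Th_eq hP ν τ w
  rw [h]
  have h1 := differentiable_e2
  have h2 : Differentiable ℂ (fun z => jacobiTheta₂ z (P * τ)) := fun z =>
    differentiableAt_jacobiTheta₂_fst z (im_nat_mul hP hτ)
  have h3 : Differentiable ℂ (fun w : ℂ => 1 / 2 + (ν + 1 / 2) * τ + P * w) := by fun_prop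
  have h4 := h2.comp h3
  apply Differentiable.mul
  · fun_prop
  · exact h4

theorem diag_zero {τ : ℂ} (hτ : 0 < τ.im) (d : ℤ) (c : ℂ) :
    HasSum (fun t : ℤ => e2 ((t : ℂ) / 2 + ((t : ℂ) ^ 2 / 2 + t * (d + 1 / 2)) * τ + c)) 0 := by
  have hs : Summable fun t : ℤ => e2 ((t : ℂ) / 2 + ((t : ℂ) ^ 2 / 2 + t * (d + 1 / 2)) * τ + c) := by
    refine ((summable_gauss hτ (1 / 2 + (d + 1 / 2) * τ)).mul_left (e2 c)).congr fun t => ?_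
    rw [← e2_add]; congr 1; ring
  have h1 := hs.hasSum
  have h2 := (Equiv.subLeft (-1 - 2 * d : ℤ)).hasSum_iff.2 h1
  have h3 : HasSum (fun t : ℤ => e2 ((t : ℂ) / 2 + ((t : ℂ) ^ 2 / 2 + t * (d + 1 / 2)) * τ + c))
      (-∑' t : ℤ, e2 ((t : ℂ) / 2 + ((t : ℂ) ^ 2 / 2 + t * (d + 1 / 2)) * τ + c)) := by
    refine h2.neg.congr_fun fun t => ?_
    simp only [Function.comp, Equiv.subLeft_apply]
    rw [← neg_one_mul, ← e2_half, ← e2_add]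
    apply e2_eq_of_sub _ _ (d + t)
    push_cast
    ring
  have h4 := h1.unique h3
  have h5 : ∑' t : ℤ, e2 ((t : ℂ) / 2 + ((t : ℂ) ^ 2 / 2 + t * (d + 1 / 2)) * τ + c) = 0 := by
    linear_combination (1 / 2 : ℂ) * h4
  rwa [h5] at h1

/-! ### The function `R` -/

def RR (τ w : ℂ) : ℂ := e2 (w / 2) * ∑' j : ℤ, lt τ τ (τ / 2 + 1 / 2) w j

def XX (P : ℕ) (ν : ℤ) (τ w : ℂ) (s j t : ℤ) : ℂ :=
  e2 ((t : ℂ) / 2 + (P : ℂ) / 2 * (t + (ν + 1 / 2) / P) ^ 2 * τ +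
    (-(((P : ℂ) - 1) / 2) * j ^ 2 + j * s) * τ + s * w)

/-- reindexing `(s, (j, t)) ↦ ((j, l), k)` -/
def eqvA (P : ℕ) (ν : ℤ) : ℤ × (ℤ × ℤ) ≃ (ℤ × ℤ) × ℤ where
  toFun p := ((p.2.1, p.1 - P * (p.2.2 + p.2.1) - ν - 1), p.2.2 + p.2.1)
  invFun p := (p.1.2 + P * p.2 + ν + 1, (p.1.1, p.2 - p.1.1))
  left_inv p := by
    ext <;> simp
    ring
  right_inv p := by
    ext <;> simp
    ring

theorem R_Th_expand {P : ℕ} (hP : 0 < P) (ν : ℤ) {τ w : ℂ} (hw0 : 0 < w.im) (hw1 : w.im < τ.im) :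
    HasSum (fun p : ℤ × (ℤ × ℤ) =>
      sg p.2.1 (p.1 - P * (p.2.2 + p.2.1) - ν - 1) * XX P ν τ w p.1 p.2.1 p.2.2)
      (RR τ w * Th P ν τ w) := by
  have hP' : (P : ℂ) ≠ 0 := by exact_mod_cast hP.ne'
  have hτ : 0 < τ.im := hw0.trans hw1
  obtain ⟨h1, h2⟩ := lt_expand (v := τ / 2 + 1 / 2) hτ hw0 hw1
  have h3 := (summable_thterm hP ν hτ w).norm
  have h4 := (summable_mul_of_summable_norm h1 h3).hasSum
  rw [← tsum_mul_tsum_of_summable_norm h1 h3, h2] at h4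
  have h5 := (eqvA P ν).hasSum_iff.2 (h4.mul_left (e2 (w / 2)))
  rw [← mul_assoc] at h5
  refine h5.congr_fun ?_
  rintro ⟨s, j, t⟩
  simp only [Function.comp, eqvA, Equiv.coe_fn_mk]
  rw [mul_assoc, mul_left_comm]
  congr 1
  rw [thterm, ← e2_add, ← e2_add, XX]
  symm
  apply e2_eq_of_sub _ _ j
  push_cast
  field_simp
  ring

theorem hasSum_line {f : ℤ × ℤ → ℂ} {g : ℤ → ℤ × ℤ} (hg : Function.Injective g) {a : ℂ}
    (h : HasSum (fun t => f (g t)) a) (h0 : ∀ p, p ∉ Set.range g → f p = 0) : HasSum f a :=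
  (hg.hasSum_iff h0).1 h

def CC (τ : ℂ) : ℂ := ∑' p : ℤ × ℤ, sg p.1 (-(p.2 + p.1) - 1) * XX 1 0 τ 0 0 p.1 p.2

theorem R_Th_one_annulus {τ w : ℂ} (hw0 : 0 < w.im) (hw1 : w.im < τ.im) :
    RR τ w * Th 1 0 τ w = CC τ := by
  have hτ : 0 < τ.im := hw0.trans hw1
  have hexp := R_Th_expand one_pos 0 hw0 hw1
  have hfs := hexp.summable.prod_factor
  have hfib := hexp.prod_fiberwise (fun s => (hfs s).hasSum)
  have hz : ∀ s : ℤ, s ≠ 0 → ∑' p : ℤ × ℤ,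
      sg p.1 (s - (1 : ℕ) * (p.2 + p.1) - 0 - 1) * XX 1 0 τ w s p.1 p.2 = 0 := by
    intro s hs
    have hK := (hfs s).hasSum
    simp only [] at hK
    set K := ∑' p : ℤ × ℤ, sg p.1 (s - (1 : ℕ) * (p.2 + p.1) - 0 - 1) * XX 1 0 τ w s p.1 p.2
    have hsh := ((Equiv.addRight ((1, 0) : ℤ × ℤ)).hasSum_iff.2 hK).mul_left (e2 (-(s * τ)))
    have hd := hsh.sub hK
    have l1 : HasSum (fun p : ℤ × ℤ => (if p.1 = -1 then 1 else 0) * XX 1 0 τ w s p.1 p.2) 0 := by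
      refine hasSum_line (g := fun t => (-1, t)) (fun a b h => by simpa using h) ?_ ?_
      · refine (diag_zero hτ 0 (τ / 8 - s * τ + s * w)).congr_fun fun t => ?_
        simp only [if_true, one_mul, XX]
        congr 1
        push_cast
        ring
      · rintro ⟨j, t⟩ h
        have : j ≠ -1 := by rintro rfl; exact h ⟨t, rfl⟩
        simp [this]
    have l2 : HasSum (fun p : ℤ × ℤ => (if s - (p.2 + p.1) - 1 = 0 then 1 else 0) *
        XX 1 0 τ w s p.1 p.2) 0 := by
      refine hasSum_line (g := fun t => (s - 1 - t, t)) (fun a b h => by simpa using h) ?_ ?_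
      · refine (diag_zero hτ (-s) (τ / 8 + (s - 1) * s * τ + s * w)).congr_fun fun t => ?_
        have : s - (t + (s - 1 - t)) - 1 = 0 := by ring
        simp only [this, if_true, one_mul, XX]
        congr 1
        push_cast
        ring
      · rintro ⟨j, t⟩ h
        have : s - (t + j) - 1 ≠ 0 := by
          intro h'; exact h ⟨t, by ext <;> simp; omega⟩
        simp [this]
    have hd2 := (l1.sub l2).unique (hd.congr_fun fun p => ?_)
    · have hne : e2 (-(s * τ)) - 1 ≠ 0 := by
        intro h0
        have h1 : ‖e2 (-(s * τ))‖ = 1 := by rw [sub_eq_zero.1 h0, norm_one]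
        rw [norm_e2, Real.exp_eq_one_iff] at h1
        have him : (-((s : ℂ) * τ)).im = -(s * τ.im) := by simp
        rw [him] at h1
        have hpi := Real.pi_pos.ne'
        have hs' : (s : ℝ) ≠ 0 := by exact_mod_cast hs
        have := hτ.ne'
        have h2 : 2 * Real.pi * (s * τ.im) ≠ 0 := by positivity
        apply h2
        linarith
      have : (e2 (-(s * τ)) - 1) * K = 0 := by linear_combination -hd2
      exact (mul_eq_zero.1 this).resolve_left hne
    · obtain ⟨j, t⟩ := p
      simp only [Function.comp, Equiv.coe_addRight, Prod.mk_add_mk, add_zero]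
      have hX : XX 1 0 τ w s (j + 1) t = e2 (s * τ) * XX 1 0 τ w s j t := by
        rw [XX, XX, ← e2_add]; congr 1; push_cast; ring
      have hc : e2 (-(s * τ)) * e2 (s * τ) = 1 := by rw [← e2_add, neg_add_cancel, e2_zero]
      have hsg : sg (j + 1) (s - (1 : ℕ) * (t + (j + 1)) - 0 - 1) =
          sg j (s - (1 : ℕ) * (t + j) - 0 - 1) + (if j = -1 then 1 else 0) -
            (if s - (t + j) - 1 = 0 then 1 else 0) := by
        unfold sg
        push_cast
        split_ifs <;> first | omega | norm_num
      rw [hX, hsg]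
      linear_combination (-(sg j (s - (1 : ℕ) * (t + j) - 0 - 1) + (if j = -1 then 1 else 0) -
            (if s - (t + j) - 1 = 0 then 1 else 0)) * XX 1 0 τ w s j t) * hc
  have h1 := hasSum_single (f := fun s : ℤ => ∑' p : ℤ × ℤ,
      sg p.1 (s - (1 : ℕ) * (p.2 + p.1) - 0 - 1) * XX 1 0 τ w s p.1 p.2) 0 hz
  rw [hfib.unique h1, CC]
  apply tsum_congr
  rintro ⟨j, t⟩
  simp only [XX]
  congr 2
  · push_cast; ring
  · push_cast; ring
/-! ### Splitting sums modulo `M` -/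

theorem tsum_split (M : ℕ) (hM : 0 < M) {f : ℤ → ℂ} (hf : Summable f) :
    ∑' s : ℤ, f s = ∑ n ∈ Finset.range M, ∑' i : ℤ, f ((n : ℤ) + M * i) := by
  have : NeZero M := ⟨hM.ne'⟩
  have h1 : ∀ p : Fin M × ℤ, ((Equiv.prodComm (Fin M) ℤ).trans (Int.divModEquiv M).symm) p =
      (p.1 : ℤ) + M * p.2 := by
    rintro ⟨n, i⟩
    simp [Int.divModEquiv]
    ring
  rw [← ((Equiv.prodComm (Fin M) ℤ).trans (Int.divModEquiv M).symm).tsum_eq]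
  have hs : Summable fun p : Fin M × ℤ => f ((p.1 : ℤ) + M * p.2) := by
    have := ((Equiv.prodComm (Fin M) ℤ).trans (Int.divModEquiv M).symm).summable_iff.2 hf
    exact this.congr fun p => by simp only [Function.comp, h1]
  simp only [h1]
  rw [hs.tsum_prod, tsum_fintype, Finset.sum_range]

/-! ### S-transformation of the theta functions -/

theorem Th_S {P : ℕ} (hP : 0 < P) (ν : ℤ) {τ : ℂ} (hτ : 0 < τ.im) (w : ℂ) :
    Th P ν (-1 / τ) (w / τ) = (-(Complex.I * τ)) ^ (1 / 2 : ℂ) / (Real.sqrt P : ℂ) *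
      e2 (P * w ^ 2 / (2 * τ)) * ∑ ν' ∈ Finset.range P,
        e2 (-((ν + 1 / 2) * (ν' + 1 / 2)) / P) * Th P (ν' : ℤ) τ w := by
  have hP' : (P : ℂ) ≠ 0 := by exact_mod_cast hP.ne'
  have hPr : (0 : ℝ) < P := by exact_mod_cast hP
  have hτ0 : τ ≠ 0 := by rintro rfl; simp at hτ
  have hτP : 0 < (τ / P).im := by
    rw [show τ / (P : ℂ) = τ / ((P : ℝ) : ℂ) by simp, Complex.div_ofReal_im]
    positivity
  have hτP0 : τ / P ≠ 0 := div_ne_zero hτ0 hP'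
  set z' : ℂ := τ / (2 * P) - (ν + 1 / 2) / P + w with hz'
  have hfe := jacobiTheta₂_functional_equation z' (τ / P)
  have hZ : z' / (τ / P) = 1 / 2 + (ν + 1 / 2) * (-1 / τ) + P * (w / τ) := by
    rw [hz']; field_simp; ring
  have hT : -1 / (τ / P) = P * (-1 / τ) := by field_simp
  rw [hZ, hT] at hfe
  have hroot : (-Complex.I * (τ / P)) ^ (1 / 2 : ℂ) =
      (-(Complex.I * τ)) ^ (1 / 2 : ℂ) / (Real.sqrt P : ℂ) := by
    have h1 : -Complex.I * (τ / P) = (((P : ℝ)⁻¹ : ℝ) : ℂ) * (-(Complex.I * τ)) := by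
      push_cast; field_simp
    have hx : -(Complex.I * τ) ≠ 0 := neg_ne_zero.2 (mul_ne_zero Complex.I_ne_zero hτ0)
    have hr : ((((P : ℝ)⁻¹ : ℝ) : ℂ)) ≠ 0 := by
      push_cast; exact inv_ne_zero hP'
    have h2 : (Real.sqrt P : ℂ) = Complex.exp (((Real.log P : ℝ) : ℂ) * (1 / 2)) := by
      rw [Real.sqrt_eq_rpow, Real.rpow_def_of_pos hPr]
      push_cast
      rfl
    rw [h1, Complex.cpow_def_of_ne_zero (mul_ne_zero hr hx), Complex.cpow_def_of_ne_zero hx,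
      Complex.log_ofReal_mul (inv_pos.2 hPr) hx, Real.log_inv, h2, ← Complex.exp_sub]
    congr 1
    push_cast
    ring
  have hr0 : (-Complex.I * (τ / P)) ^ (1 / 2 : ℂ) ≠ 0 := by
    rw [Ne, Complex.cpow_eq_zero_iff]
    intro h
    exact (mul_ne_zero (neg_ne_zero.2 Complex.I_ne_zero) hτP0) h.1
  have hθ : jacobiTheta₂ (1 / 2 + (ν + 1 / 2) * (-1 / τ) + P * (w / τ)) (P * (-1 / τ)) =
      (-Complex.I * (τ / P)) ^ (1 / 2 : ℂ) * e2 (z' ^ 2 * P / (2 * τ)) *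
        jacobiTheta₂ z' (τ / P) := by
    rw [hfe]
    have : e2 (z' ^ 2 * P / (2 * τ)) * Complex.exp (-Real.pi * Complex.I * z' ^ 2 / (τ / P)) = 1 := by
      rw [e2, ← Complex.exp_add, ← Complex.exp_zero]
      congr 1
      field_simp
      ring
    generalize jacobiTheta₂ (1 / 2 + (ν + 1 / 2) * (-1 / τ) + P * (w / τ)) (P * (-1 / τ)) = J
    calc J = ((-Complex.I * (τ / P)) ^ (1 / 2 : ℂ) * (1 / (-Complex.I * (τ / P)) ^ (1 / 2 : ℂ))) *
          (e2 (z' ^ 2 * P / (2 * τ)) *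
            Complex.exp (-Real.pi * Complex.I * z' ^ 2 / (τ / P))) * J := by
          rw [this, mul_one_div_cancel hr0]; ring
      _ = _ := by ring
  have hsplit : jacobiTheta₂ z' (τ / P) = ∑ ν' ∈ Finset.range P, ∑' k : ℤ,
      e2 ((((ν' : ℤ) + P * k : ℤ) : ℂ) ^ 2 / 2 * (τ / P) + (((ν' : ℤ) + P * k : ℤ) : ℂ) * z') := by
    have h := tsum_split P hP (summable_gauss hτP z')
    rw [← h]
    unfold jacobiTheta₂
    exact tsum_congr fun j => (e2_term _ _ _).symm
  rw [Th_eq hP, hθ, hroot, hsplit]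
  rw [Finset.mul_sum, Finset.mul_sum, Finset.mul_sum]
  apply Finset.sum_congr rfl
  intro ν' _
  rw [Th]
  rw [← tsum_mul_left, ← tsum_mul_left, ← tsum_mul_left, ← tsum_mul_left]
  apply tsum_congr
  intro k
  set ρ := (-(Complex.I * τ)) ^ (1 / 2 : ℂ) / (Real.sqrt P : ℂ)
  rw [thterm]
  have key : e2 ((ν + 1 / 2) ^ 2 / (2 * P) * (-1 / τ) + (ν + 1 / 2) * (w / τ)) *
      e2 (z' ^ 2 * P / (2 * τ)) *
      e2 ((((ν' : ℤ) + P * k : ℤ) : ℂ) ^ 2 / 2 * (τ / P) + (((ν' : ℤ) + P * k : ℤ) : ℂ) * z') =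
      e2 (P * w ^ 2 / (2 * τ)) * e2 (-((ν + 1 / 2) * (ν' + 1 / 2)) / P) *
      e2 ((k : ℂ) / 2 + (P : ℂ) / 2 * (k + (((ν' : ℤ) : ℂ) + 1 / 2) / P) ^ 2 * τ +
        (P * k + ((ν' : ℤ) : ℂ) + 1 / 2) * w) := by
    rw [← e2_add, ← e2_add, ← e2_add, ← e2_add]
    apply e2_eq_of_sub _ _ (-(k * (ν + 1)))
    rw [hz']
    push_cast
    field_simp
    ring
  linear_combination ρ * key

/-! ### Analytic continuation off the lattice -/

def offLat (τ : ℂ) : Set ℂ := {w | ∀ k l : ℤ, w ≠ k + l * τ}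

theorem offLat_ne {τ w : ℂ} (hw : w ∈ offLat τ) (j : ℤ) : e2 (w + j * τ) ≠ 1 := by
  intro h
  obtain ⟨k, hk⟩ := (e2_eq_one_iff _).1 h
  apply hw k (-j)
  push_cast
  linear_combination hk

theorem strip_offLat {τ w : ℂ} (hw0 : 0 < w.im) (hw1 : w.im < τ.im) : w ∈ offLat τ := by
  intro k l h
  have hτ : 0 < τ.im := hw0.trans hw1
  have him : w.im = l * τ.im := by rw [h]; simp
  rw [him] at hw0 hw1
  have h1 : (0 : ℝ) < l := by
    by_contra h; nlinarith
  have h2 : (l : ℝ) < 1 := by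
    by_contra h; nlinarith
  have h1' : 0 < l := by exact_mod_cast h1
  have h2' : l < 1 := by exact_mod_cast h2
  omega

theorem offLat_ext {τ : ℂ} (hτ : 0 < τ.im) {f g : ℂ → ℂ} (hf : ∀ w ∈ offLat τ, AnalyticAt ℂ f w)
    (hg : ∀ w ∈ offLat τ, AnalyticAt ℂ g w)
    (h : ∀ w : ℂ, 0 < w.im → w.im < τ.im → f w = g w) : ∀ w ∈ offLat τ, f w = g w := by
  have hU : offLat τ = (Set.range (fun p : ℤ × ℤ => (p.1 : ℂ) + p.2 * τ))ᶜ := by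
    ext w
    simp only [offLat, Set.mem_ofPred_eq, Set.mem_compl_iff, Set.mem_range, not_exists, Prod.forall]
    exact ⟨fun h a b hab => h a b hab.symm, fun h a b hab => h a b hab.symm⟩
  have hpre : IsPreconnected (offLat τ) := by
    rw [hU]
    exact ((Set.countable_range _).isConnected_compl_of_one_lt_rank (by simp)).isPreconnected
  have him : (τ / 2).im = τ.im / 2 := by
    rw [show τ / 2 = τ / ((2 : ℝ) : ℂ) by simp, Complex.div_ofReal_im]
  have h0 : τ / 2 ∈ offLat τ := strip_offLat (by rw [him]; linarith) (by rw [him]; linarith)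
  have hev : f =ᶠ[nhds (τ / 2)] g := by
    have hc : ContinuousAt Complex.im (τ / 2) := Complex.continuous_im.continuousAt
    filter_upwards [hc.eventually (lt_mem_nhds (by rw [him]; linarith : (0 : ℝ) < (τ / 2).im)),
      hc.eventually (gt_mem_nhds (by rw [him]; linarith : (τ / 2).im < τ.im))] with w h1 h2
    exact h w h1 h2
  exact AnalyticOnNhd.eqOn_of_preconnected_of_eventuallyEq hf hg hpre h0 hev

theorem lerch_analytic' {T τ : ℂ} (hT : 0 < T.im) (hτ : 0 < τ.im) (v₀ : ℂ) (N : ℝ) {w₀ : ℂ}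
    (hw : w₀ ∈ offLat τ) :
    Summable (fun j : ℤ => lt T τ (v₀ + N * w₀) w₀ j) ∧
    AnalyticAt ℂ (fun w => ∑' j : ℤ, lt T τ (v₀ + N * w) w j) w₀ := by
  have := lerch_analytic hT hτ v₀ w₀ N Set.univ (fun j _ => offLat_ne hw j)
  simpa using this

theorem e2_analytic (f : ℂ → ℂ) (hf : Differentiable ℂ f) (w : ℂ) :
    AnalyticAt ℂ (fun w => e2 (f w)) w :=
  (differentiable_e2.comp hf).analyticAt w

theorem RR_analytic {τ : ℂ} (hτ : 0 < τ.im) {w₀ : ℂ} (hw : w₀ ∈ offLat τ) :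
    AnalyticAt ℂ (RR τ) w₀ := by
  have h := (lerch_analytic' hτ hτ (τ / 2 + 1 / 2) 0 hw).2
  simp only [Complex.ofReal_zero, zero_mul, add_zero] at h
  exact (e2_analytic (fun w => w / 2) (by fun_prop) w₀).mul h

theorem R_Th_one {τ : ℂ} (hτ : 0 < τ.im) {w : ℂ} (hw : w ∈ offLat τ) :
    RR τ w * Th 1 0 τ w = CC τ := by
  refine offLat_ext hτ (f := fun w => RR τ w * Th 1 0 τ w) (g := fun _ => CC τ) ?_ ?_ ?_ w hw
  · intro w hw
    exact (RR_analytic hτ hw).mul ((Th_differentiable one_pos 0 hτ).analyticAt w)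
  · intro w _
    exact analyticAt_const
  · intro w h0 h1
    exact R_Th_one_annulus h0 h1

/-! ### The pole of `R` -/

theorem near_zero_offLat {τ : ℂ} (hτ : 0 < τ.im) : ∀ᶠ w in nhdsWithin (0 : ℂ) {0}ᶜ, w ∈ offLat τ := by
  have h1 : ∀ j ∈ ({0}ᶜ : Set ℤ), e2 ((0 : ℂ) + j * τ) ≠ 1 := by
    intro j hj h
    obtain ⟨k, hk⟩ := (e2_eq_one_iff _).1 h
    have := congrArg Complex.im hk
    simp at this
    rcases this with h | h
    · exact hj (by simpa using h)
    · exact hτ.ne' h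
  obtain ⟨B, hB⟩ := den_bound hτ 0 {0}ᶜ h1
  have hb : ∀ᶠ w in nhdsWithin (0 : ℂ) {0}ᶜ, w ∈ Metric.ball (0 : ℂ) 1 :=
    mem_nhdsWithin_of_mem_nhds (Metric.ball_mem_nhds _ one_pos)
  filter_upwards [mem_nhdsWithin_of_mem_nhds hB, self_mem_nhdsWithin, hb] with w hw hw0 hw1 k l hkl
  by_cases hl : l = 0
  · subst hl
    simp only [Int.cast_zero, zero_mul, add_zero] at hkl
    rw [hkl, Metric.mem_ball, dist_zero_right, Complex.norm_intCast] at hw1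
    have : |k| < 1 := by exact_mod_cast hw1
    have : k = 0 := by rwa [Int.abs_lt_one_iff] at this
    apply hw0
    rw [hkl, this]; simp
  · have h2 := (hw (-l) (by simpa using hl)).1
    apply h2
    rw [hkl]
    have : (k : ℂ) + l * τ + ((-l : ℤ) : ℂ) * τ = (k : ℤ) := by push_cast; ring
    rw [this, e2_int, sub_self]

theorem RR_pole {τ : ℂ} (hτ : 0 < τ.im) :
    Filter.Tendsto (fun w => w * RR τ w) (nhdsWithin (0 : ℂ) {0}ᶜ)
      (nhds (-(2 * (Real.pi : ℂ) * Complex.I)⁻¹)) := by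
  classical
  have h1 : ∀ j ∈ ({0}ᶜ : Set ℤ), e2 ((0 : ℂ) + j * τ) ≠ 1 := by
    intro j hj h
    obtain ⟨k, hk⟩ := (e2_eq_one_iff _).1 h
    have := congrArg Complex.im hk
    simp at this
    rcases this with h | h
    · exact hj (by simpa using h)
    · exact hτ.ne' h
  have hA := (lerch_analytic hτ hτ (τ / 2 + 1 / 2) 0 0 {0}ᶜ h1).2.continuousAt
  simp only [Complex.ofReal_zero, zero_mul, add_zero] at hA
  have hd : HasDerivAt e2 (2 * (Real.pi : ℂ) * Complex.I) 0 := by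
    have h := ((hasDerivAt_id (0 : ℂ)).const_mul (2 * (Real.pi : ℂ) * Complex.I)).cexp
    simp only [id_eq, mul_zero, Complex.exp_zero, one_mul, mul_one] at h
    exact h
  have hs := hasDerivAt_iff_tendsto_slope.1 hd
  have hs2 := (hs.inv₀ Complex.two_pi_I_ne_zero).neg
  have hm : Filter.Tendsto (fun w : ℂ => e2 (w / 2) * (-(slope e2 0 w)⁻¹ + w * ∑' j : ℤ,
      if j ∈ ({0}ᶜ : Set ℤ) then lt τ τ (τ / 2 + 1 / 2) w j else 0)) (nhdsWithin (0 : ℂ) {0}ᶜ)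
      (nhds (1 * (-(2 * (Real.pi : ℂ) * Complex.I)⁻¹ + 0 * ∑' j : ℤ,
      if j ∈ ({0}ᶜ : Set ℤ) then lt τ τ (τ / 2 + 1 / 2) 0 j else 0))) := by
    have hid : Filter.Tendsto (fun w : ℂ => w) (nhdsWithin (0 : ℂ) {0}ᶜ) (nhds 0) :=
      Filter.tendsto_id.mono_left nhdsWithin_le_nhds
    have he : Filter.Tendsto (fun w : ℂ => e2 (w / 2)) (nhdsWithin (0 : ℂ) {0}ᶜ) (nhds 1) := by
      have hc : Continuous fun w : ℂ => e2 (w / 2) := by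
        have := differentiable_e2.continuous
        fun_prop
      have := (hc.tendsto 0).mono_left (nhdsWithin_le_nhds (s := {0}ᶜ))
      simpa [e2_zero] using this
    exact he.mul (hs2.add (hid.mul (hA.tendsto.mono_left nhdsWithin_le_nhds)))
  rw [zero_mul, add_zero, one_mul] at hm
  refine hm.congr' ?_
  filter_upwards [near_zero_offLat hτ, self_mem_nhdsWithin] with w hw hw0
  have hsum := (lerch_analytic' hτ hτ (τ / 2 + 1 / 2) 0 hw).1
  simp only [Complex.ofReal_zero, zero_mul, add_zero] at hsum
  rw [RR, hsum.tsum_eq_add_tsum_ite 0, mul_left_comm]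
  congr 1
  rw [mul_add]
  congr 1
  · rw [slope_def_field, lt, e2_zero]
    have hne := offLat_ne hw 0
    simp only [Int.cast_zero, zero_mul, add_zero] at hne
    have h2 : 1 - e2 w ≠ 0 := sub_ne_zero.2 (Ne.symm hne)
    have h3 : e2 w - 1 ≠ 0 := sub_ne_zero.2 hne
    simp [e2_zero]
    field_simp
    ring
  · congr 1
    apply tsum_congr
    intro j
    by_cases hj : j = 0 <;> simp [hj]

/-! ### Non-vanishing of the constant -/

theorem jtheta2_ne {T : ℂ} (hT : 0 < T.im) : ∃ z, jacobiTheta₂ z T ≠ 0 := by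
  by_contra hcon
  push Not at hcon
  have hIntg : ∀ n : ℤ, n ≠ 0 → ∫ x in (0 : ℝ)..1, Complex.exp (2 * Real.pi * Complex.I * n * x) = 0 := by
    intro n hn
    have hc : 2 * (Real.pi : ℂ) * Complex.I * n ≠ 0 :=
      mul_ne_zero Complex.two_pi_I_ne_zero (by exact_mod_cast hn)
    rw [integral_exp_mul_complex hc]
    have := e2_int n
    rw [e2] at this
    simp [this]
  have h1 := (summable_jacobiTheta₂_term_iff (0 : ℂ) T).2 hT
  set f : ℤ → C(ℝ, ℂ) := fun n => ⟨fun x => jacobiTheta₂_term n 0 T *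
    Complex.exp (2 * Real.pi * Complex.I * n * x), by fun_prop⟩ with hf
  have hb : ∀ n : ℤ, ∀ x : ℝ, f n x = jacobiTheta₂_term n (x : ℂ) T := by
    intro n x
    simp only [hf, ContinuousMap.coe_mk, jacobiTheta₂_term, ← Complex.exp_add]
    congr 1; ring
  have hn : ∀ n : ℤ, ∀ x : ℝ, ‖f n x‖ = ‖jacobiTheta₂_term n 0 T‖ := by
    intro n x
    simp only [hf, ContinuousMap.coe_mk, norm_mul]
    rw [show 2 * (Real.pi : ℂ) * Complex.I * n * x = ((2 * Real.pi * n * x : ℝ) : ℂ) * Complex.I by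
      push_cast; ring, Complex.norm_exp_ofReal_mul_I, mul_one]
  have hs : Summable fun n : ℤ => ‖(f n).restrict (⟨Set.uIcc (0 : ℝ) 1, isCompact_uIcc⟩ :
      TopologicalSpace.Compacts ℝ)‖ := by
    refine Summable.of_nonneg_of_le (fun _ => norm_nonneg _) (fun n => ?_) h1.norm
    refine (ContinuousMap.norm_le _ (norm_nonneg _)).2 fun x => ?_
    exact (hn n x).le
  have hsum := intervalIntegral.hasSum_intervalIntegral_of_summable_norm hs
  have hz : ∀ x : ℝ, ∑' n : ℤ, f n x = 0 := by
    intro x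
    rw [← hcon x, jacobiTheta₂]
    exact tsum_congr fun n => hb n x
  simp only [hz, intervalIntegral.integral_zero] at hsum
  have h2 : HasSum (fun n : ℤ => ∫ x in (0 : ℝ)..1, f n x) 1 := by
    have : (fun n : ℤ => ∫ x in (0 : ℝ)..1, f n x) = fun n : ℤ => if n = 0 then 1 else 0 := by
      funext n
      simp only [hf, ContinuousMap.coe_mk, intervalIntegral.integral_const_mul]
      split_ifs with h
      · subst h; simp [jacobiTheta₂_term]
      · rw [hIntg n h, mul_zero]
    rw [this]
    exact hasSum_ite_eq 0 1
  exact zero_ne_one (hsum.unique h2)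

theorem CC_ne {τ : ℂ} (hτ : 0 < τ.im) : CC τ ≠ 0 := by
  intro hC
  have hev : ∀ᶠ w in nhdsWithin (0 : ℂ) {0}ᶜ, Th 1 0 τ w = 0 := by
    have h1 := (RR_pole hτ).eventually_ne (neg_ne_zero.2 (inv_ne_zero Complex.two_pi_I_ne_zero))
    filter_upwards [h1, near_zero_offLat hτ] with w h2 h3
    have h4 := R_Th_one hτ h3
    rw [hC] at h4
    rcases mul_eq_zero.1 h4 with h | h
    · exact absurd (by rw [h, mul_zero]) h2
    · exact h
  have han : AnalyticOnNhd ℂ (Th 1 0 τ) Set.univ := fun w _ =>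
    (Th_differentiable one_pos 0 hτ).analyticAt w
  have hzero := han.eqOn_zero_of_preconnected_of_frequently_eq_zero isPreconnected_univ
    (Set.mem_univ 0) hev.frequently
  obtain ⟨z, hz⟩ := jtheta2_ne hτ
  have h5 : Th 1 0 τ (z - 1 / 2 - τ / 2) = 0 := hzero (Set.mem_univ _)
  rw [Th_eq one_pos] at h5
  rcases mul_eq_zero.1 h5 with h | h
  · exact e2_ne_zero _ h
  · apply hz
    rw [← h]
    congr 1
    · push_cast; ring
    · push_cast; ring

theorem RR_S {τ : ℂ} (hτ : 0 < τ.im) {w : ℂ} (hw : w ∈ offLat τ) :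
    RR (-1 / τ) (w / τ) = τ * e2 (-(w ^ 2) / (2 * τ)) * RR τ w := by
  have hτ0 : τ ≠ 0 := by rintro rfl; simp at hτ
  have hτ' : 0 < (-1 / τ).im := by
    have := UpperHalfPlane.im_inv_neg_coe_pos ⟨τ, hτ⟩
    rw [show (-1 : ℂ) / τ = (-τ)⁻¹ by rw [neg_div, one_div, inv_neg]]
    exact this
  have hoff : ∀ w ∈ offLat τ, w / τ ∈ offLat (-1 / τ) := by
    intro w hw k l h
    apply hw (-l) k
    field_simp at h
    push_cast
    linear_combination h
  set κ : ℂ := (-(Complex.I * τ)) ^ (1 / 2 : ℂ) * e2 (-(1 / 4)) with hκ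
  have hκ0 : κ ≠ 0 := by
    refine mul_ne_zero ?_ (e2_ne_zero _)
    rw [Ne, Complex.cpow_eq_zero_iff]
    intro h
    exact (neg_ne_zero.2 (mul_ne_zero Complex.I_ne_zero hτ0)) h.1
  have hTh : ∀ w, Th 1 0 (-1 / τ) (w / τ) = κ * e2 (w ^ 2 / (2 * τ)) * Th 1 0 τ w := by
    intro w
    rw [Th_S one_pos 0 hτ w, hκ]
    simp
    rw [show -((2 : ℂ)⁻¹ * 2⁻¹) = -(1 / 4) by norm_num, show -(4 : ℂ)⁻¹ = -(1 / 4) by norm_num]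
    ring
  have key : ∀ w ∈ offLat τ, RR (-1 / τ) (w / τ) * κ * e2 (w ^ 2 / (2 * τ)) * CC τ =
      CC (-1 / τ) * RR τ w := by
    intro w hw
    rw [← R_Th_one hτ hw, ← R_Th_one hτ' (hoff w hw), hTh]
    ring
  have hlim : τ * κ * CC τ = CC (-1 / τ) := by
    have hneb : (nhdsWithin (0 : ℂ) {0}ᶜ).NeBot := inferInstance
    have hscale : Filter.Tendsto (fun w : ℂ => w / τ) (nhdsWithin (0 : ℂ) {0}ᶜ)
        (nhdsWithin (0 : ℂ) {0}ᶜ) := by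
      apply tendsto_nhdsWithin_of_tendsto_nhds_of_eventually_within
      · have : Continuous fun w : ℂ => w / τ := by fun_prop
        have := (this.tendsto 0).mono_left (nhdsWithin_le_nhds (s := {0}ᶜ))
        simpa using this
      · filter_upwards [self_mem_nhdsWithin] with w hw0
        exact div_ne_zero hw0 hτ0
    have h1 := (RR_pole hτ').comp hscale
    have he : Filter.Tendsto (fun w : ℂ => e2 (w ^ 2 / (2 * τ))) (nhdsWithin (0 : ℂ) {0}ᶜ) (nhds 1) := by
      have hc : Continuous fun w : ℂ => e2 (w ^ 2 / (2 * τ)) := by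
        have := differentiable_e2.continuous
        fun_prop
      have := (hc.tendsto 0).mono_left (nhdsWithin_le_nhds (s := {0}ᶜ))
      simpa [e2_zero] using this
    have h2 := (h1.mul he).const_mul (τ * κ * CC τ)
    have h3 := (RR_pole hτ).const_mul (CC (-1 / τ))
    have h4 := tendsto_nhds_unique (h2.congr' (f₂ := fun w => CC (-1 / τ) * (w * RR τ w)) (by
      filter_upwards [near_zero_offLat hτ] with w hw
      have := key w hw
      simp only [Function.comp]
      have e : τ * κ * CC τ * (w / τ * RR (-1 / τ) (w / τ) * e2 (w ^ 2 / (2 * τ))) =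
        (w * (τ / τ)) * (RR (-1 / τ) (w / τ) * κ * e2 (w ^ 2 / (2 * τ)) * CC τ) := by ring
      rw [e, this, div_self hτ0]
      ring)) h3
    rw [mul_one] at h4
    exact mul_right_cancel₀ (neg_ne_zero.2 (inv_ne_zero Complex.two_pi_I_ne_zero)) h4
  have h := key w hw
  rw [← hlim] at h
  have hE : e2 (-(w ^ 2) / (2 * τ)) * e2 (w ^ 2 / (2 * τ)) = 1 := by
    rw [← e2_add, ← e2_zero]; congr 1; ring
  have hne : κ * e2 (w ^ 2 / (2 * τ)) * CC τ ≠ 0 :=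
    mul_ne_zero (mul_ne_zero hκ0 (e2_ne_zero _)) (CC_ne hτ)
  apply mul_right_cancel₀ hne
  linear_combination h - τ * κ * CC τ * RR τ w * hE

/-! ### The indefinite double sum -/

def gt (M : ℕ) (n ν : ℤ) (τ : ℂ) (J p : ℤ) : ℂ :=
  (-1 : ℂ) ^ J *
      e2 ((((M : ℂ) / 2 + 1 / 2) * ((J : ℂ) + (ν : ℂ) - ((ν : ℂ) + 1 / 2) / (2 * ((M : ℂ) / 2) + 1)) ^ 2 -
        (M : ℂ) / 2 * ((p : ℂ) + (ν : ℂ) - (n : ℂ) / (2 * ((M : ℂ) / 2))) ^ 2) * τ)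

def rho (κ : ℤ) (q : ℤ × ℤ) : ℂ := (if κ < q.1 - q.2 then 1 else 0) - (if q.2 ≤ 0 then 1 else 0)

theorem M1_ne (M : ℕ) : (M : ℂ) + 1 ≠ 0 := by exact_mod_cast Nat.succ_ne_zero M

theorem diag_gt {M : ℕ} (hM : 0 < M) (n ν κ : ℤ) {τ : ℂ} (hτ : 0 < τ.im) :
    HasSum (fun q : ℤ × ℤ => if q.1 - q.2 = κ then gt M n ν τ q.1 q.2 else 0) 0 := by
  have hM' : (M : ℂ) ≠ 0 := by exact_mod_cast hM.ne'
  have hM1 := M1_ne M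
  refine hasSum_line (g := fun p : ℤ => (p + κ, p)) (fun a b h => by simpa using h) ?_ ?_
  · have h := diag_zero hτ ((M + 1) * κ + n - 1) ((κ : ℂ) / 2 +
      (((M : ℂ) + 1) / 2 * (κ + ν - (ν + 1 / 2) / (M + 1)) ^ 2 - (M : ℂ) / 2 * (ν - n / M) ^ 2) * τ)
    refine h.congr_fun fun p => ?_
    simp only [add_sub_cancel_left, if_true]
    rw [gt, neg_one_zpow_e2, ← e2_add]
    congr 1
    push_cast
    field_simp
    ring
  · rintro ⟨J, p⟩ h
    simp only
    rw [if_neg]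
    intro h2
    exact h ⟨p, by simp; omega⟩

theorem rho_step {M : ℕ} (hM : 0 < M) (n ν κ : ℤ) {τ : ℂ} (hτ : 0 < τ.im) (S : ℂ) :
    HasSum (fun q : ℤ × ℤ => rho κ q * gt M n ν τ q.1 q.2) S ↔
    HasSum (fun q : ℤ × ℤ => rho (κ - 1) q * gt M n ν τ q.1 q.2) S := by
  have hd := diag_gt hM n ν κ hτ
  have hid : ∀ q : ℤ × ℤ, rho (κ - 1) q * gt M n ν τ q.1 q.2 = rho κ q * gt M n ν τ q.1 q.2 +
      (if q.1 - q.2 = κ then gt M n ν τ q.1 q.2 else 0) := by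
    intro q
    have : (if κ - 1 < q.1 - q.2 then (1 : ℂ) else 0) = (if κ < q.1 - q.2 then 1 else 0) +
        (if q.1 - q.2 = κ then 1 else 0) := by
      split_ifs <;> first | omega | simp
    rw [rho, rho, this]
    split_ifs <;> ring
  constructor
  · intro h
    have := h.add hd
    rw [add_zero] at this
    exact this.congr_fun hid
  · intro h
    have := h.sub hd
    rw [sub_zero] at this
    exact this.congr_fun fun q => by rw [hid q]; ring

theorem rho_all {M : ℕ} (hM : 0 < M) (n ν κ : ℤ) {τ : ℂ} (hτ : 0 < τ.im) (S : ℂ) :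
    HasSum (fun q : ℤ × ℤ => rho κ q * gt M n ν τ q.1 q.2) S ↔
    HasSum (fun q : ℤ × ℤ => rho (-1) q * gt M n ν τ q.1 q.2) S := by
  induction κ using Int.inductionOn' with
  | b => exact -1
  | zero => exact Iff.rfl
  | succ k _ ih => rw [rho_step hM n ν (k + 1) hτ S, add_sub_cancel_right, ih]
  | pred k _ ih => rw [← rho_step hM n ν k hτ S, ih]

theorem gfun_of_hasSum {M : ℕ} (n ν : ℤ) {τ : ℂ} {S : ℂ}
    (h : HasSum (fun q : ℤ × ℤ => rho (-1) q * gt M n ν τ q.1 q.2) S) :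
    gfun ((M : ℂ) / 2) n ν τ = S := by
  rw [← h.tsum_eq, gfun, indefSum]
  apply tsum_congr
  rintro ⟨J, p⟩
  simp only [rho]
  rw [← gt]
  split_ifs <;> first | omega | simp

/-! ### The function `H` -/

def HH (M : ℕ) (ν : ℤ) (τ w : ℂ) : ℂ :=
  e2 (-(M * ν * w)) * ∑' j : ℤ, lt (M * τ) τ (-(M * ν * τ) + (M : ℝ) * w) w j

/-- reindexing `(s, (j, t)) ↦ ((j, l), t)` -/
def eqvB (M : ℕ) (ν : ℤ) : ℤ × (ℤ × ℤ) ≃ (ℤ × ℤ) × ℤ where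
  toFun p := ((p.2.1, p.1 - M * p.2.1 + M * ν), p.2.2)
  invFun p := (p.1.2 + M * p.1.1 - M * ν, (p.1.1, p.2))
  left_inv p := by
    ext <;> simp
    ring
  right_inv p := by
    ext <;> simp
    ring

theorem H_Th_expand {M : ℕ} (hM : 0 < M) (ν : ℤ) {τ w : ℂ} (hw0 : 0 < w.im) (hw1 : w.im < τ.im) :
    HasSum (fun p : ℤ × (ℤ × ℤ) =>
      sg p.2.1 (p.1 - M * p.2.1 + M * ν) * XX (M + 1) ν τ w p.1 p.2.1 p.2.2)
      (HH M ν τ w * Th (M + 1) ν τ 0) := by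
  have hτ : 0 < τ.im := hw0.trans hw1
  obtain ⟨h1, h2⟩ := lt_expand (v := -(M * ν * τ) + (M : ℝ) * w) (im_nat_mul hM hτ) hw0 hw1
  have h3 := (summable_thterm (P := M + 1) (Nat.succ_pos M) ν hτ 0).norm
  have h4 := (summable_mul_of_summable_norm h1 h3).hasSum
  have h5 := tsum_mul_tsum_of_summable_norm h1 h3
  rw [← h5, h2] at h4
  have h6 := ((eqvB M ν).hasSum_iff.2 h4).mul_left (e2 (-(M * ν * w)))
  rw [HH, mul_assoc]
  refine h6.congr_fun fun p => ?_
  obtain ⟨s, j, t⟩ := p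
  simp only [Function.comp, eqvB, Equiv.coe_fn_mk, XX, thterm]
  rw [mul_assoc (sg _ _), ← e2_add, mul_left_comm, ← e2_add]
  congr 2
  push_cast
  ring

theorem claim1_annulus {M : ℕ} (hM : 0 < M) (ν : ℤ) {τ w : ℂ} (hw0 : 0 < w.im) (hw1 : w.im < τ.im) :
    RR τ w * Th (M + 1) ν τ w = (∑ n ∈ Finset.range M, (-1 : ℂ) ^ ν * gfun ((M : ℂ) / 2) n ν τ *
      jtheta 1 n ((M : ℂ) / 2) τ (2 * w)) + HH M ν τ w * Th (M + 1) ν τ 0 := by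
  have hM' : (M : ℂ) ≠ 0 := by exact_mod_cast hM.ne'
  have hM1 := M1_ne M
  have hτ : 0 < τ.im := hw0.trans hw1
  have hD := (R_Th_expand (P := M + 1) (Nat.succ_pos M) ν hw0 hw1).sub (H_Th_expand hM ν hw0 hw1)
  have hfs := hD.summable.prod_factor
  have hfib := hD.prod_fiberwise (fun s => (hfs s).hasSum)
  have h1 := tsum_split M hM hfib.summable
  rw [hfib.tsum_eq] at h1
  rw [← sub_eq_iff_eq_add, h1]
  apply Finset.sum_congr rfl
  intro n hn
  have hn' : (n : ℤ) < M := by exact_mod_cast Finset.mem_range.1 hn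
  rw [jtheta, ← tsum_mul_left]
  apply tsum_congr
  intro i
  rw [one_zpow, one_mul]
  set E := e2 ((M : ℂ) / 2 * ((i : ℂ) + n / (2 * ((M : ℂ) / 2))) ^ 2 * τ +
    (M : ℂ) / 2 * ((i : ℂ) + n / (2 * ((M : ℂ) / 2))) * (2 * w)) with hE
  have hE0 : E ≠ 0 := e2_ne_zero _
  let eqv : ℤ × ℤ ≃ ℤ × ℤ :=
    { toFun := fun q => (q.2 + i + ν, -q.1 - ν)
      invFun := fun q => (-q.2 - ν, q.1 - i - ν)
      left_inv := fun q => by ext <;> simp <;> ring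
      right_inv := fun q => by ext <;> simp <;> ring }
  have h2 := eqv.hasSum_iff.2 (hfs (n + M * i)).hasSum
  have h3 : HasSum (fun q : ℤ × ℤ => rho ((i + ν - n) / ((M : ℤ) + 1)) q * gt M n ν τ q.1 q.2)
      ((-1 : ℂ) ^ ν * E⁻¹ * ∑' c : ℤ × ℤ, (sg c.1 ((n + M * i : ℤ) - ((M + 1 : ℕ) : ℤ) * (c.2 + c.1) - ν - 1) * XX (M + 1) ν τ w (n + M * i : ℤ) c.1 c.2 -
        sg c.1 ((n + M * i : ℤ) - M * c.1 + M * ν) * XX (M + 1) ν τ w (n + M * i : ℤ) c.1 c.2)) := by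
    refine (h2.mul_left ((-1 : ℂ) ^ ν * E⁻¹)).congr_fun fun q => ?_
    obtain ⟨J, p⟩ := q
    simp only [Function.comp, eqv, Equiv.coe_fn_mk]
    have hX : XX (M + 1) ν τ w (n + M * i) (p + i + ν) (-J - ν) =
        (-1 : ℂ) ^ ν * E * gt M n ν τ J p := by
      rw [XX, hE, gt, neg_one_zpow_e2, neg_one_zpow_e2, ← e2_add, ← e2_add, ← e2_add]
      apply e2_eq_of_sub _ _ (-J - ν)
      push_cast
      field_simp
      ring
    have hr : sg (p + i + ν) ((n + M * i : ℤ) - ((M + 1 : ℕ) : ℤ) * ((-J - ν) + (p + i + ν)) - ν - 1) -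
        sg (p + i + ν) ((n + M * i : ℤ) - M * (p + i + ν) + M * ν) =
        rho ((i + ν - n) / ((M : ℤ) + 1)) (J, p) := by
      rw [sg, sg, rho]
      have c1 : (0 ≤ (n + M * i : ℤ) - ((M + 1 : ℕ) : ℤ) * ((-J - ν) + (p + i + ν)) - ν - 1) ↔
          (i + ν - n) / ((M : ℤ) + 1) < J - p := by
        rw [Int.ediv_lt_iff_lt_mul (by positivity)]
        have : (n + M * i : ℤ) - ((M + 1 : ℕ) : ℤ) * ((-J - ν) + (p + i + ν)) - ν - 1 =
          (J - p) * ((M : ℤ) + 1) - (i + ν - n) - 1 := by push_cast; ring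
        rw [this]
        omega
      have c2 : (0 ≤ (n + M * i : ℤ) - M * (p + i + ν) + M * ν) ↔ p ≤ 0 := by
        have : (n + M * i : ℤ) - M * (p + i + ν) + M * ν = n - M * p := by ring
        rw [this]
        constructor
        · intro h
          by_contra hp
          have : 1 ≤ p := by omega
          have : (M : ℤ) * 1 ≤ M * p := mul_le_mul_of_nonneg_left this (by positivity)
          omega
        · intro h
          have : (M : ℤ) * p ≤ 0 := mul_nonpos_of_nonneg_of_nonpos (by positivity) h
          omega
      simp only [c1, c2]
      ring
    have hsq : (-1 : ℂ) ^ ν * (-1 : ℂ) ^ ν = 1 := by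
      rw [← mul_zpow]; simp
    rw [← sub_mul, hr, hX]
    calc _ = ((-1 : ℂ) ^ ν * (-1 : ℂ) ^ ν) * (E⁻¹ * E) * (rho ((i + ν - n) / ((M : ℤ) + 1)) (J, p) * gt M n ν τ J p) := by
          rw [hsq, inv_mul_cancel₀ hE0]; ring
      _ = _ := by ring
  have h4 := gfun_of_hasSum _ _ ((rho_all hM n ν _ hτ _).1 h3)
  rw [h4]
  have hsq : (-1 : ℂ) ^ ν * (-1 : ℂ) ^ ν = 1 := by
    rw [← mul_zpow]; simp
  calc _ = ((-1 : ℂ) ^ ν * (-1 : ℂ) ^ ν) * (E⁻¹ * E) * _ := by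
        rw [hsq, inv_mul_cancel₀ hE0, one_mul, one_mul]
    _ = _ := by ring

theorem e2_mul_div (x y c : ℂ) : e2 x * (e2 y / c) = e2 (x + y) / c := by
  rw [mul_div_assoc', e2_add]

/-! ### The key identity off the lattice -/

theorem jtheta_one_eq {M : ℕ} (hM : 0 < M) (n : ℂ) (τ w : ℂ) :
    jtheta 1 n ((M : ℂ) / 2) τ (2 * w) = e2 (n ^ 2 / (2 * M) * τ + n * w) *
      jacobiTheta₂ (n * τ + M * w) (M * τ) := by
  have hM' : (M : ℂ) ≠ 0 := by exact_mod_cast hM.ne'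
  unfold jtheta jacobiTheta₂
  rw [← tsum_mul_left]
  apply tsum_congr
  intro k
  rw [one_zpow, one_mul, ← e2_term, ← e2_add]
  congr 1
  field_simp
  ring

theorem jtheta_one_analytic {M : ℕ} (hM : 0 < M) (n : ℂ) {τ : ℂ} (hτ : 0 < τ.im) (w : ℂ) :
    AnalyticAt ℂ (fun w => jtheta 1 n ((M : ℂ) / 2) τ (2 * w)) w := by
  have h : (fun w => jtheta 1 n ((M : ℂ) / 2) τ (2 * w)) = fun w => e2 (n ^ 2 / (2 * M) * τ + n * w) *
      jacobiTheta₂ (n * τ + M * w) (M * τ) := funext fun w => jtheta_one_eq hM n τ w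
  rw [h]
  have h1 := differentiable_e2
  have h2 : Differentiable ℂ (fun z => jacobiTheta₂ z (M * τ)) := fun z =>
    differentiableAt_jacobiTheta₂_fst z (im_nat_mul hM hτ)
  have h3 : Differentiable ℂ (fun w : ℂ => n * τ + M * w) := by fun_prop
  have h4 : Differentiable ℂ fun w : ℂ => jacobiTheta₂ (n * τ + M * w) (M * τ) := h2.comp h3
  exact (e2_analytic (fun w => n ^ 2 / (2 * M) * τ + n * w) (by fun_prop) w).mul (h4.analyticAt w)

theorem claim1 {M : ℕ} (hM : 0 < M) (ν : ℤ) {τ w : ℂ} (hτ : 0 < τ.im) (hw : w ∈ offLat τ) :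
    RR τ w * Th (M + 1) ν τ w = (∑ n ∈ Finset.range M, (-1 : ℂ) ^ ν * gfun ((M : ℂ) / 2) n ν τ *
      jtheta 1 n ((M : ℂ) / 2) τ (2 * w)) + HH M ν τ w * Th (M + 1) ν τ 0 := by
  refine offLat_ext hτ (f := fun w => RR τ w * Th (M + 1) ν τ w)
    (g := fun w => (∑ n ∈ Finset.range M, (-1 : ℂ) ^ ν * gfun ((M : ℂ) / 2) n ν τ *
      jtheta 1 n ((M : ℂ) / 2) τ (2 * w)) + HH M ν τ w * Th (M + 1) ν τ 0) ?_ ?_ ?_ w hw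
  · intro w hw
    exact (RR_analytic hτ hw).mul ((Th_differentiable (Nat.succ_pos M) ν hτ).analyticAt w)
  · intro w hw
    refine AnalyticAt.add ?_ (AnalyticAt.mul ?_ analyticAt_const)
    · refine Finset.analyticAt_fun_sum _ fun n _ => ?_
      exact analyticAt_const.mul (jtheta_one_analytic hM n hτ w)
    · exact (e2_analytic (fun w => -(M * ν * w)) (by fun_prop) w).mul
        (lerch_analytic' (im_nat_mul hM hτ) hτ (-(M * ν * τ)) M hw).2
  · intro w h0 h1
    exact claim1_annulus hM ν h0 h1

theorem offLat_div {M : ℕ} {τ w : ℂ} (hw : (M : ℂ) * w ∈ offLat τ) : w ∈ offLat τ := by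
  intro k l h
  apply hw (M * k) (M * l)
  rw [h]; push_cast; ring

theorem offLat_mul {M : ℕ} {τ w : ℂ} (hw : (M : ℂ) * w ∈ offLat τ) :
    (M : ℂ) * w ∈ offLat (M * τ) := by
  intro k l h
  apply hw k (l * M)
  rw [h]; push_cast; ring

theorem sum_hfun {M : ℕ} (hM : 0 < M) (ν : ℤ) {τ w : ℂ} (hτ : 0 < τ.im) (hw : (M : ℂ) * w ∈ offLat τ) :
    ∑ n ∈ Finset.range M, e2 (-((M : ℂ) / 2 * (ν : ℂ) ^ 2) * τ) * hfun ((M : ℂ) / 2) n ν τ (2 * w) =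
      HH M ν τ w := by
  have hM' : (M : ℂ) ≠ 0 := by exact_mod_cast hM.ne'
  have hMτ := im_nat_mul hM hτ
  have hterm : ∀ n : ℕ, e2 (-((M : ℂ) / 2 * (ν : ℂ) ^ 2) * τ) * hfun ((M : ℂ) / 2) n ν τ (2 * w) =
      ∑' j : ℤ, e2 (n * w - M * ν * w) *
        lt (M * τ) (M * τ) (n * τ - M * ν * τ + M * w + (0 : ℝ) * (M * w)) (M * w) j := by
    intro n
    rw [hfun, ← (Equiv.subRight ν).tsum_eq, ← tsum_mul_left]
    apply tsum_congr
    intro j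
    rw [lt, e2_mul_div, e2_mul_div]
    simp only [Equiv.subRight_apply]
    congr 1
    · congr 1
      push_cast
      ring
    · congr 2
      push_cast
      ring
  have hsum : ∀ n : ℕ, Summable fun j : ℤ => e2 (n * w - M * ν * w) *
        lt (M * τ) (M * τ) (n * τ - M * ν * τ + M * w + (0 : ℝ) * (M * w)) (M * w) j := by
    intro n
    exact (lerch_analytic' hMτ hMτ (n * τ - M * ν * τ + M * w) 0 (offLat_mul hw)).1.mul_left _
  simp only [hterm]
  rw [← Summable.tsum_finsetSum (fun n _ => hsum n), HH, ← tsum_mul_left]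
  apply tsum_congr
  intro j
  have hY : e2 (w + j * τ) ≠ 1 := offLat_ne (offLat_div hw) j
  have hYM : e2 (M * w + j * (M * τ)) = e2 (w + j * τ) ^ M := by
    rw [← e2_nat_mul]; congr 1; ring
  have hYM1 : e2 (w + j * τ) ^ M ≠ 1 := by
    rw [← hYM]; exact offLat_ne (offLat_mul hw) j
  have hg := geom_sum_eq hY M
  have h1 : ∀ n ∈ Finset.range M, e2 (n * w - M * ν * w) *
        lt (M * τ) (M * τ) (n * τ - M * ν * τ + M * w + (0 : ℝ) * (M * w)) (M * w) j =
      (e2 (-(M * ν * w)) * e2 ((j : ℂ) ^ 2 / 2 * (M * τ) + j * (-(M * ν * τ) + (M : ℝ) * w)) /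
        (1 - e2 (w + j * τ) ^ M)) * e2 (w + j * τ) ^ n := by
    intro n _
    rw [lt, hYM, e2_mul_div, div_mul_eq_mul_div (e2 _ * e2 _), ← e2_nat_mul n, ← e2_add, ← e2_add]
    congr 2
    push_cast
    ring
  rw [Finset.sum_congr rfl h1, ← Finset.mul_sum, hg, lt]
  have n1 : 1 - e2 (w + j * τ) ≠ 0 := sub_ne_zero.2 hY.symm
  have n2 : e2 (w + j * τ) - 1 ≠ 0 := sub_ne_zero.2 hY
  have n3 : 1 - e2 (w + j * τ) ^ M ≠ 0 := sub_ne_zero.2 hYM1.symm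
  generalize e2 ((j : ℂ) ^ 2 / 2 * (M * τ) + j * (-(M * ν * τ) + (M : ℝ) * w)) = A
  generalize e2 (w + j * τ) = Y at *
  field_simp
  ring

/-- The sum of the `G_n` over `n`. -/
def phi (M : ℕ) (ν : ℤ) (τ w : ℂ) : ℂ := (-1 : ℂ) ^ ν * (RR τ w * Th (M + 1) ν τ w)

theorem neg_one_sq_zpow (ν : ℤ) : (-1 : ℂ) ^ ν * (-1 : ℂ) ^ ν = 1 := by
  rw [← mul_zpow]; simp

theorem sum_Gfun {M : ℕ} (hM : 0 < M) (ν : ℤ) {τ w : ℂ} (hτ : 0 < τ.im) (hw : (M : ℂ) * w ∈ offLat τ) :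
    ∑ n ∈ Finset.range M, Gfun ((M : ℂ) / 2) n ν τ (2 * w) = phi M ν τ w := by
  rw [phi, claim1 hM ν hτ (offLat_div hw), ← sum_hfun hM ν hτ hw, mul_add, Finset.mul_sum,
    Finset.sum_mul, Finset.mul_sum, ← Finset.sum_add_distrib]
  apply Finset.sum_congr rfl
  intro n _
  have h := jtheta_eq_Th (M + 1) (Nat.succ_pos M) ν τ 0
  rw [mul_zero, show ((M + 1 : ℕ) : ℂ) / 2 = (M : ℂ) / 2 + 1 / 2 by push_cast; ring] at h
  rw [Gfun, h]
  push_cast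
  linear_combination (-(gfun ((M : ℂ) / 2) n ν τ * jtheta 1 n ((M : ℂ) / 2) τ (2 * w))) *
    neg_one_sq_zpow ν

theorem Gfun_shift {M : ℕ} (hM : 0 < M) (n ν : ℤ) (τ z : ℂ) (b : ℤ) :
    Gfun ((M : ℂ) / 2) n ν τ (z + b / ((M : ℂ) / 2)) = e2 (n * b / M) * Gfun ((M : ℂ) / 2) n ν τ z := by
  have hM' : (M : ℂ) ≠ 0 := by exact_mod_cast hM.ne'
  have h1 : jtheta 1 n ((M : ℂ) / 2) τ (z + b / ((M : ℂ) / 2)) =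
      e2 (n * b / M) * jtheta 1 n ((M : ℂ) / 2) τ z := by
    rw [jtheta, jtheta, ← tsum_mul_left]
    apply tsum_congr
    intro j
    rw [one_zpow, one_mul, one_mul, ← e2_add]
    apply e2_eq_of_sub _ _ (j * b)
    push_cast
    field_simp
    ring
  have h2 : hfun ((M : ℂ) / 2) n ν τ (z + b / ((M : ℂ) / 2)) =
      e2 (n * b / M) * hfun ((M : ℂ) / 2) n ν τ z := by
    rw [hfun, hfun, ← tsum_mul_left]
    apply tsum_congr
    intro j
    rw [e2_mul_div]
    congr 1
    · apply e2_eq_of_sub _ _ (j * b)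
      push_cast
      field_simp
      ring
    · congr 1
      apply e2_eq_of_sub _ _ b
      field_simp
      ring
  rw [Gfun, Gfun, h1, h2]
  ring

theorem phi_shift {M : ℕ} (hM : 0 < M) (ν : ℤ) {τ w : ℂ} (hτ : 0 < τ.im) (hw : (M : ℂ) * w ∈ offLat τ)
    (b : ℤ) : phi M ν τ (w + b / M) =
      ∑ n ∈ Finset.range M, e2 (n * b / M) * Gfun ((M : ℂ) / 2) n ν τ (2 * w) := by
  have hM' : (M : ℂ) ≠ 0 := by exact_mod_cast hM.ne'
  have hw' : (M : ℂ) * (w + b / M) ∈ offLat τ := by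
    intro k l h
    apply hw (k - b) l
    field_simp at h
    push_cast
    linear_combination h
  rw [← sum_Gfun hM ν hτ hw']
  apply Finset.sum_congr rfl
  intro n _
  have := Gfun_shift hM n ν τ (2 * w) b
  rw [Int.cast_natCast] at this
  rw [← this]
  congr 1
  ring

theorem root_sum {M : ℕ} (hM : 0 < M) {n n' : ℕ} (hn : n < M) (hn' : n' < M) :
    ∑ b ∈ Finset.range M, e2 (-(n * b) / M) * e2 (n' * b / M) = if n' = n then (M : ℂ) else 0 := by
  have hM' : (M : ℂ) ≠ 0 := by exact_mod_cast hM.ne'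
  have h1 : ∀ b ∈ Finset.range M, e2 (-((n : ℂ) * (b : ℂ)) / M) * e2 (n' * b / M) =
      e2 (((n' : ℂ) - n) / M) ^ b := by
    intro b _
    rw [← e2_add, ← e2_nat_mul]; congr 1; ring
  rw [Finset.sum_congr rfl h1]
  split_ifs with h
  · subst h; simp [e2_zero]
  · have hne : e2 (((n' : ℂ) - n) / M) ≠ 1 := by
      intro h2
      obtain ⟨k, hk⟩ := (e2_eq_one_iff _).1 h2
      rw [div_eq_iff hM'] at hk
      have hk' : (n' : ℤ) - n = k * M := by exact_mod_cast hk
      have hdvd : (M : ℤ) ∣ (n' : ℤ) - n := ⟨k, by rw [hk']; ring⟩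
      have := Int.eq_zero_of_abs_lt_dvd hdvd (by rw [abs_lt]; constructor <;> omega)
      omega
    rw [geom_sum_eq hne, ← e2_nat_mul, mul_div_cancel₀ _ hM']
    have := e2_int ((n' : ℤ) - n)
    push_cast at this
    rw [this]; simp

theorem G_of_phi {M : ℕ} (hM : 0 < M) {n : ℕ} (hn : n < M) (ν : ℤ) {τ w : ℂ} (hτ : 0 < τ.im)
    (hw : (M : ℂ) * w ∈ offLat τ) :
    (M : ℂ) * Gfun ((M : ℂ) / 2) n ν τ (2 * w) =
      ∑ b ∈ Finset.range M, e2 (-(n * b) / M) * phi M ν τ (w + b / M) := by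
  have h1 : ∀ b ∈ Finset.range M, e2 (-((n : ℂ) * (b : ℂ)) / M) * phi M ν τ (w + b / M) =
      ∑ n' ∈ Finset.range M, (e2 (-(n * b) / M) * e2 (n' * b / M)) *
        Gfun ((M : ℂ) / 2) n' ν τ (2 * w) := by
    intro b _
    have := phi_shift hM ν hτ hw b
    rw [Int.cast_natCast] at this
    rw [this, Finset.mul_sum]
    exact Finset.sum_congr rfl fun n' _ => by ring
  rw [Finset.sum_congr rfl h1, Finset.sum_comm]
  simp only [← Finset.sum_mul]
  rw [Finset.sum_congr rfl fun n' hn' => by rw [root_sum hM hn (Finset.mem_range.1 hn')]]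
  simp [hn]

theorem phi_S (M : ℕ) (ν : ℤ) {τ w : ℂ} (hτ : 0 < τ.im) (hw : w ∈ offLat τ) :
    phi M ν (-1 / τ) (w / τ) = τ * (-(Complex.I * τ)) ^ (1 / 2 : ℂ) / (Real.sqrt ((M : ℝ) + 1) : ℂ) *
      e2 (M * w ^ 2 / (2 * τ)) * ∑ ν' ∈ Finset.range (M + 1), (-1 : ℂ) ^ (ν + (ν' : ℤ)) *
        e2 (-((ν + 1 / 2) * (ν' + 1 / 2)) / (M + 1)) * phi M ν' τ w := by
  have h := Th_S (Nat.succ_pos M) ν hτ w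
  simp only [Nat.succ_eq_add_one, Nat.cast_add, Nat.cast_one] at h
  rw [phi, RR_S hτ hw, h]
  have hE : e2 (M * w ^ 2 / (2 * τ)) = e2 (-(w ^ 2) / (2 * τ)) * e2 ((M + 1) * w ^ 2 / (2 * τ)) := by
    rw [← e2_add]; congr 1; ring
  rw [hE]
  simp only [Finset.mul_sum]
  apply Finset.sum_congr rfl
  intro ν' _
  rw [phi, zpow_add₀ (by norm_num : (-1 : ℂ) ≠ 0)]
  have hsq := neg_one_sq_zpow (ν' : ℤ)
  set ε := (-1 : ℂ) ^ (ν' : ℤ)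
  calc _ = (ε * ε) * _ := by rw [hsq, one_mul]
    _ = _ := by ring

theorem im_S_pos {τ : ℂ} (hτ : 0 < τ.im) : 0 < (-1 / τ).im := by
  have := UpperHalfPlane.im_inv_neg_coe_pos ⟨τ, hτ⟩
  rw [show (-1 : ℂ) / τ = (-τ)⁻¹ by rw [neg_div, one_div, inv_neg]]
  exact this

theorem stmt_15 (M : ℕ) (hM : 0 < M) (m : ℂ) (hm : m = (M : ℂ) / 2)
    (n ν : ℤ) (hn : 0 ≤ n ∧ n < (M : ℤ)) (hν : 0 ≤ ν ∧ ν ≤ (M : ℤ)) (a : ℤ)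
    (τ : ℂ) (hτ : 0 < τ.im) (z : ℂ)
    (hz : ∀ k l : ℤ, m * z ≠ (k : ℂ) + (l : ℂ) * τ) :
    Ffun m a 0 n ν (-1 / τ) (z / τ) =
      Complex.I * (-(Complex.I * τ)) ^ ((3 : ℂ) / 2) /
          (2 * m * (Real.sqrt ((M : ℝ) + 1) : ℂ)) *
        e2 ((a : ℂ) * z / (2 * τ)) * e2 (-((a : ℂ) ^ 2) / (4 * m * τ)) *
        e2 (m * (z - (a : ℂ) / m) ^ 2 / (4 * τ)) *
        ∑ n' ∈ Finset.range M, ∑ ν' ∈ Finset.range (M + 1), ∑ ℓ ∈ Finset.range M,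
          (-1 : ℂ) ^ (ν + (ν' : ℤ)) *
            e2 (-(((ν : ℂ) + 1 / 2) * ((ν' : ℂ) + 1 / 2)) / (2 * m + 1)) *
            e2 (-((n' : ℂ) * (a : ℂ)) / (2 * m)) *
            e2 (-(((n : ℂ) + (a : ℂ)) * (ℓ : ℂ)) / (2 * m)) *
            Ffun m (ℓ : ℤ) 0 (n' : ℤ) (ν' : ℤ) τ z := by
  subst hm
  have hM' : (M : ℂ) ≠ 0 := by exact_mod_cast hM.ne'
  have hτ0 : τ ≠ 0 := by rintro rfl; simp at hτ
  have hτ' := im_S_pos hτ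
  obtain ⟨w, rfl⟩ : ∃ w, z = 2 * w := ⟨z / 2, by ring⟩
  lift n to ℕ using hn.1
  have hnM : n < M := by exact_mod_cast hn.2
  have hw : (M : ℂ) * w ∈ offLat τ := by
    intro k l h
    apply hz k l
    rw [← h]; ring
  set W : ℕ → ℂ := fun b => w - a / M + b * τ / M with hW
  have hWoff : ∀ b, W b ∈ offLat τ := by
    intro b
    apply offLat_div (M := M)
    intro k l h
    apply hw (k + a) (l - b)
    simp only [hW] at h
    field_simp at h
    push_cast
    linear_combination h
  have hw1 : (M : ℂ) * ((w - a / M) / τ) ∈ offLat (-1 / τ) := by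
    intro k l h
    apply hw (a - l) k
    field_simp at h
    push_cast
    linear_combination h
  have hw2 : ∀ b : ℕ, (M : ℂ) * (w + b * τ / M) ∈ offLat τ := by
    intro b k l h
    apply hw k (l - b)
    field_simp at h
    push_cast
    linear_combination h
  have hphi : ∀ (b : ℕ) (ν' : ℕ), phi M ν' τ (W b) = ∑ n' ∈ Finset.range M,
      e2 (-((n' : ℂ) * a) / M) * Gfun ((M : ℂ) / 2) n' ν' τ (2 * (w + b * τ / M)) := by
    intro b ν'
    have h := phi_shift hM ν' hτ (hw2 b) (-a)
    rw [show W b = w + b * τ / M + ((-a : ℤ) : ℂ) / M by simp only [hW]; push_cast; ring, h]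
    apply Finset.sum_congr rfl
    intro n' _
    congr 2
    push_cast
    ring
  have hG := G_of_phi hM hnM ν hτ' hw1
  have hpt : ∀ b : ℕ, (w - a / M) / τ + b / M = W b / τ := by
    intro b
    simp only [hW]
    field_simp
  simp only [hpt] at hG
  replace hG := (eq_inv_mul_iff_mul_eq₀ hM').2 hG
  rw [Ffun, show 2 * w / τ + (a : ℂ) * (-1 / τ) / ((M : ℂ) / 2) + ((0 : ℤ) : ℂ) / ((M : ℂ) / 2) =
    2 * ((w - a / M) / τ) by push_cast; field_simp; ring]
  have hroot : Complex.I * (-(Complex.I * τ)) ^ ((3 : ℂ) / 2) =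
      τ * (-(Complex.I * τ)) ^ (1 / 2 : ℂ) := by
    rw [show (3 : ℂ) / 2 = 1 + 1 / 2 by norm_num, Complex.cpow_add _ _
      (neg_ne_zero.2 (mul_ne_zero Complex.I_ne_zero hτ0)), Complex.cpow_one]
    linear_combination (-τ * (-(Complex.I * τ)) ^ (1 / 2 : ℂ)) * Complex.I_mul_I
  rw [hroot, hG]
  have hstep : ∀ b ∈ Finset.range M, e2 (-((n : ℂ) * (b : ℂ)) / M) * phi M ν (-1 / τ) (W b / τ) =
      ∑ n' ∈ Finset.range M, ∑ ν' ∈ Finset.range (M + 1),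
        τ * (-(Complex.I * τ)) ^ (1 / 2 : ℂ) / (Real.sqrt ((M : ℝ) + 1) : ℂ) *
        e2 ((M : ℂ) / 2 * (2 * w - (a : ℂ) / ((M : ℂ) / 2)) ^ 2 / (4 * τ)) *
        ((-1 : ℂ) ^ (ν + (ν' : ℤ)) *
            e2 (-(((ν : ℂ) + 1 / 2) * ((ν' : ℂ) + 1 / 2)) / (2 * ((M : ℂ) / 2) + 1)) *
            e2 (-((n' : ℂ) * (a : ℂ)) / (2 * ((M : ℂ) / 2))) *
            e2 (-((((n : ℤ) : ℂ) + (a : ℂ)) * (b : ℂ)) / (2 * ((M : ℂ) / 2))) *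
            Ffun ((M : ℂ) / 2) (b : ℤ) 0 (n' : ℤ) (ν' : ℤ) τ (2 * w)) := by
    intro b _
    rw [phi_S M ν hτ (hWoff b), Finset.sum_comm, Finset.mul_sum, Finset.mul_sum]
    apply Finset.sum_congr rfl
    intro ν' _
    rw [hphi, Finset.mul_sum, Finset.mul_sum, Finset.mul_sum]
    apply Finset.sum_congr rfl
    intro n' _
    rw [Ffun, show 2 * w + ((b : ℤ) : ℂ) * τ / ((M : ℂ) / 2) + ((0 : ℤ) : ℂ) / ((M : ℂ) / 2) =
      2 * (w + b * τ / M) by push_cast; field_simp; ring]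
    rw [show 2 * ((M : ℂ) / 2) = M by ring]
    have hE : e2 (-((n : ℂ) * (b : ℂ)) / M) * e2 (M * W b ^ 2 / (2 * τ)) =
        e2 ((M : ℂ) / 2 * (2 * w - (a : ℂ) / ((M : ℂ) / 2)) ^ 2 / (4 * τ)) *
        e2 (-((((n : ℤ) : ℂ) + (a : ℂ)) * (b : ℂ)) / M) *
        e2 (((b : ℤ) : ℂ) * (2 * w) / 2 + ((b : ℤ) : ℂ) ^ 2 / (4 * ((M : ℂ) / 2)) * τ) := by
      rw [← e2_add, ← e2_add, ← e2_add]
      congr 1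
      simp only [hW]
      push_cast
      field_simp
      ring
    set GG := Gfun ((M : ℂ) / 2) n' ν' τ (2 * (w + b * τ / M))
    set A := τ * (-(Complex.I * τ)) ^ (1 / 2 : ℂ) / (Real.sqrt ((M : ℝ) + 1) : ℂ)
    set B := e2 (-(((ν : ℂ) + 1 / 2) * ((ν' : ℂ) + 1 / 2)) / ((M : ℂ) + 1))
    set D := e2 (-((n' : ℂ) * (a : ℂ)) / M)
    linear_combination A * (-1 : ℂ) ^ (ν + (ν' : ℤ)) * B * D * GG * hE
  rw [Finset.sum_congr rfl hstep, Finset.sum_comm]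
  have hE2 : e2 ((a : ℂ) * (2 * w / τ) / 2 + (a : ℂ) ^ 2 / (4 * ((M : ℂ) / 2)) * (-1 / τ)) =
      e2 ((a : ℂ) * (2 * w) / (2 * τ)) * e2 (-((a : ℂ) ^ 2) / (4 * ((M : ℂ) / 2) * τ)) := by
    rw [← e2_add]; congr 1; field_simp
  rw [hE2]
  simp only [Finset.mul_sum]
  apply Finset.sum_congr rfl
  intro n' _
  rw [Finset.sum_comm]
  apply Finset.sum_congr rfl
  intro ν' _
  apply Finset.sum_congr rfl
  intro b _
  rw [show (2 : ℂ) * ((M : ℂ) / 2) = M by ring]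
  ring
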